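/- Let G be a graph containing a cycle, let ℓ(G) be the smallest integer ℓ such that the cycles of G of length at most ℓ generate the cycle space of G, and let tw(G) be the tree-width of G. Then G has a tree-decomposition in which every part induces a connected subgraph and which has width at most tw(G)·(ℓ(G) − 2). -/

import Mathlib

open SimpleGraph

universe u

/-- `x` and `y` are joined by a walk in `G` all of whose vertices lie in `S`. -/
def ConnIn {V : Type u} (G : SimpleGraph V) (S : Set V) (x y : V) : Prop :=
  ∃ p : G.Walk x y, ∀ v ∈ p.support, v ∈ S

/-- `S` is a (nonempty) connected vertex set of `G`, i.e. `G[S]` is connected. -/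
def IsConnSet {V : Type u} (G : SimpleGraph V) (S : Set V) : Prop :=
  S.Nonempty ∧ ∀ x ∈ S, ∀ y ∈ S, ConnIn G S x y

/-- A tree-decomposition of `G` over the tree `T`. -/
structure TreeDecomp {V ι : Type u} (G : SimpleGraph V) (T : SimpleGraph ι) where
  isTree : T.IsTree
  bag : ι → Set V
  exists_bag : ∀ v : V, ∃ t, v ∈ bag t
  exists_bag_adj : ∀ ⦃u v : V⦄, G.Adj u v → ∃ t, u ∈ bag t ∧ v ∈ bag t
  bag_sep : ∀ ⦃t₁ t₃ : ι⦄ (p : T.Walk t₁ t₃), p.IsPath → ∀ t₂ ∈ p.support,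
      bag t₁ ∩ bag t₃ ⊆ bag t₂

/-- The union of the bags `B u` over `u ∈ A`. -/
def unionBags {V ι : Type u} (B : ι → Set V) (A : Set ι) : Set V := ⋃ u ∈ A, B u

/-- `s` is a descendant of `t` in the tree `T` rooted at `r`:
`t` lies on the (unique) `r`–`s` path. -/
def Desc {ι : Type u} (T : SimpleGraph ι) (r t s : ι) : Prop :=
  ∃ p : T.Walk r s, p.IsPath ∧ t ∈ p.support

/-- The set of descendants of `t` (the subtree `T_t`). -/
def descSet {ι : Type u} (T : SimpleGraph ι) (r t : ι) : Set ι := {s | Desc T r t s}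

/-- `s` is a child of `t` in the tree `T` rooted at `r`. -/
def IsChild {ι : Type u} (T : SimpleGraph ι) (r t s : ι) : Prop :=
  T.Adj t s ∧ Desc T r t s

/-- The vertex set of the component of `t₁` in `T` minus the edge `t₁t₂`. -/
def Side {ι : Type u} (T : SimpleGraph ι) (t₁ t₂ : ι) : Set ι :=
  {u | ∃ p : T.Walk u t₁, p.IsPath ∧ t₂ ∉ p.support}

/-- The family of bags `B` is stable: for every tree edge `t₁t₂`, both sides
induce connected subgraphs of `G`. -/
def StableBags {V ι : Type u} (G : SimpleGraph V) (T : SimpleGraph ι) (B : ι → Set V) : Prop :=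
  ∀ ⦃t₁ t₂ : ι⦄, T.Adj t₁ t₂ → IsConnSet G (unionBags B (Side T t₁ t₂))

def TreeDecomp.Stable {V ι : Type u} {G : SimpleGraph V} {T : SimpleGraph ι}
    (td : TreeDecomp G T) : Prop :=
  StableBags G T td.bag

/-- `P` is a `t`-admissible path (w.r.t. the root `r` and bags `B`): a shortest
path lying in `V_{T_t}` joining two distinct components of `G[B t]`. -/
structure IsAdmissible {V ι : Type u} (G : SimpleGraph V) (T : SimpleGraph ι)
    (B : ι → Set V) (r t : ι) {x y : V} (P : G.Walk x y) : Prop where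
  isPath : P.IsPath
  support_sub : ∀ v ∈ P.support, v ∈ unionBags B (descSet T r t)
  fst_mem : x ∈ B t
  snd_mem : y ∈ B t
  not_conn : ¬ ConnIn G (B t) x y
  minimal : ∀ ⦃x' y' : V⦄ (Q : G.Walk x' y'), Q.IsPath →
      (∀ v ∈ Q.support, v ∈ unionBags B (descSet T r t)) →
      x' ∈ B t → y' ∈ B t → ¬ ConnIn G (B t) x' y' → P.length ≤ Q.length

/-- The updated bags obtained by adding the path `P` as in `(*)`:
`W_u = V_u ∪ (V(P) ∩ V_{T_u})` for descendants `u` of `t`, and `W_u = V_u` otherwise. -/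
def updatedBag {V ι : Type u} (T : SimpleGraph ι) (B : ι → Set V) (r t : ι)
    {G : SimpleGraph V} {x y : V} (P : G.Walk x y) (u : ι) : Set V :=
  B u ∪ {v | Desc T r t u ∧ v ∈ P.support ∧ v ∈ unionBags B (descSet T r u)}

/-- The tree-width of `G`: the least `k` such that `G` has a tree-decomposition
all of whose bags have at most `k + 1` vertices. -/
noncomputable def treewidth {V : Type u} (G : SimpleGraph V) : ℕ :=
  sInf {k | ∃ (ι : Type u) (T : SimpleGraph ι) (td : TreeDecomp G T),
    ∀ t, (td.bag t).ncard ≤ k + 1}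

/-- A tree-decomposition is connected if every bag is a connected vertex set. -/
def TreeDecomp.IsConn {V ι : Type u} {G : SimpleGraph V} {T : SimpleGraph ι}
    (td : TreeDecomp G T) : Prop :=
  ∀ t, IsConnSet G (td.bag t)

/-- The connected tree-width of `G`. -/
noncomputable def ctw {V : Type u} (G : SimpleGraph V) : ℕ :=
  sInf {k | ∃ (ι : Type u) (T : SimpleGraph ι) (td : TreeDecomp G T),
    td.IsConn ∧ ∀ t, (td.bag t).ncard ≤ k + 1}

/-- The weak connected tree-width of `G`: the least `k` such that `G` has a
tree-decomposition each of whose bags is contained in a connected set of at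
most `k + 1` vertices. -/
noncomputable def wctw {V : Type u} (G : SimpleGraph V) : ℕ :=
  sInf {k | ∃ (ι : Type u) (T : SimpleGraph ι) (td : TreeDecomp G T),
    ∀ t, ∃ X, td.bag t ⊆ X ∧ IsConnSet G X ∧ X.ncard ≤ k + 1}

/-- The characteristic vector over GF(2) of the edge set of a walk. -/
noncomputable def walkChar {V : Type u} {G : SimpleGraph V} {x y : V}
    (p : G.Walk x y) : Sym2 V → ZMod 2 :=
  fun e => by classical exact if e ∈ p.edges then 1 else 0

/-- The characteristic vectors of the cycles of `G` of length at most `ℓ`. -/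
def cycleChars {V : Type u} (G : SimpleGraph V) (ℓ : ℕ) : Set (Sym2 V → ZMod 2) :=
  {f | ∃ (v : V) (p : G.Walk v v), p.IsCycle ∧ p.length ≤ ℓ ∧ f = walkChar p}

/-- The cycles of length at most `ℓ` generate the cycle space of `G` over GF(2). -/
def GeneratesLE {V : Type u} (G : SimpleGraph V) (ℓ : ℕ) : Prop :=
  ∀ ⦃v : V⦄ (p : G.Walk v v), p.IsCycle →
    walkChar p ∈ Submodule.span (ZMod 2) (cycleChars G ℓ)

/-- `ℓ(G)`: the least `ℓ` such that the cycles of length at most `ℓ`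
generate the cycle space of `G`. -/
noncomputable def ellGraph {V : Type u} (G : SimpleGraph V) : ℕ :=
  sInf {ℓ | GeneratesLE G ℓ}

/-- `Γ` is a set of cycles of `G` generating its cycle space over GF(2). -/
def GeneratesSet {V : Type u} (G : SimpleGraph V) (Γ : Set (Σ v : V, G.Walk v v)) : Prop :=
  (∀ c ∈ Γ, c.2.IsCycle) ∧
  ∀ ⦃v : V⦄ (p : G.Walk v v), p.IsCycle →
    walkChar p ∈ Submodule.span (ZMod 2) {f | ∃ c ∈ Γ, f = walkChar c.2}

/-- A bramble: a collection of connected vertex sets, any two of which have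
connected union. -/
def IsBramble {V : Type u} (G : SimpleGraph V) (B : Set (Set V)) : Prop :=
  (∀ S ∈ B, IsConnSet G S) ∧ ∀ S ∈ B, ∀ S' ∈ B, IsConnSet G (S ∪ S')

/-- `X` is a connected cover of the bramble `B`. -/
def IsConnCover {V : Type u} (G : SimpleGraph V) (B : Set (Set V)) (X : Set V) : Prop :=
  IsConnSet G X ∧ ∀ S ∈ B, (X ∩ S).Nonempty

/-- The connected order of a bramble: the least size of a connected cover. -/
noncomputable def connOrder {V : Type u} (G : SimpleGraph V) (B : Set (Set V)) : ℕ :=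
  sInf {n | ∃ X, IsConnCover G B X ∧ X.ncard = n}

/-- The maximum connected order of a bramble of `G`. -/
noncomputable def cbn {V : Type u} (G : SimpleGraph V) : ℕ :=
  sSup {n | ∃ B, IsBramble G B ∧ connOrder G B = n}

/-- A geodesic cycle: a cycle containing a shortest `G`-path between any two
of its vertices. -/
def IsGeodesicCycle {V : Type u} (G : SimpleGraph V) {v : V} (p : G.Walk v v) : Prop :=
  p.IsCycle ∧ ∀ x ∈ p.support, ∀ y ∈ p.support,
    ∃ q : G.Walk x y, q.length = G.dist x y ∧ ∀ e ∈ q.edges, e ∈ p.edges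

/-- The graph obtained from `K_n` by subdividing every edge exactly `k` times:
the edge between `i < j` is replaced by the path
`i, ((i,j),0), ((i,j),1), …, ((i,j),k-1), j`. -/
def subK (n k : ℕ) : SimpleGraph (Fin n ⊕ ({p : Fin n × Fin n // p.1 < p.2} × Fin k)) :=
  SimpleGraph.fromRel fun u v =>
    match u, v with
    | Sum.inl i, Sum.inl j => i < j ∧ k = 0
    | Sum.inl i, Sum.inr (e, c) =>
        (e.val.1 = i ∧ (c : ℕ) = 0) ∨ (e.val.2 = i ∧ (c : ℕ) = k - 1)
    | Sum.inr (e, c), Sum.inr (e', c') => e = e' ∧ (c' : ℕ) = (c : ℕ) + 1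
    | _, _ => False

/-! ### Connectivity inside a vertex set -/

section ConnIn

variable {V : Type u} {G : SimpleGraph V} {S S' Q : Set V} {x y z : V}

theorem ConnIn.refl (h : x ∈ S) : ConnIn G S x x := ⟨.nil, by simpa using h⟩

theorem ConnIn.symm (h : ConnIn G S x y) : ConnIn G S y x := by
  obtain ⟨p, hp⟩ := h
  exact ⟨p.reverse, by simpa using hp⟩

theorem ConnIn.trans (h : ConnIn G S x y) (h' : ConnIn G S y z) : ConnIn G S x z := by
  obtain ⟨p, hp⟩ := h
  obtain ⟨q, hq⟩ := h'
  refine ⟨p.append q, fun v hv => ?_⟩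
  rw [Walk.mem_support_append_iff] at hv
  exact hv.elim (hp v) (hq v)

theorem ConnIn.mono (h : ConnIn G S x y) (hS : S ⊆ S') : ConnIn G S' x y := by
  obtain ⟨p, hp⟩ := h
  exact ⟨p, fun v hv => hS (hp v hv)⟩

theorem ConnIn.of_adj (h : G.Adj x y) (hx : x ∈ S) (hy : y ∈ S) : ConnIn G S x y :=
  ⟨.cons h .nil, by simp [hx, hy]⟩

theorem ConnIn.mem_left (h : ConnIn G S x y) : x ∈ S := by
  obtain ⟨p, hp⟩ := h
  exact hp _ p.start_mem_support

theorem ConnIn.mem_right (h : ConnIn G S x y) : y ∈ S := h.symm.mem_left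

theorem ConnIn.of_walk (p : G.Walk x y) : ConnIn G {v | v ∈ p.support} x y :=
  ⟨p, fun _ hv => hv⟩

/-- A walk in `S` starting in `Q` either stays in `Q`, or leaves `Q` through an edge. -/
theorem ConnIn.inter_or_exit (h : ConnIn G S x y) (hx : x ∈ Q) :
    ConnIn G (S ∩ Q) x y ∨
      ∃ a b, ConnIn G (S ∩ Q) x a ∧ b ∈ S ∧ b ∉ Q ∧ G.Adj a b := by
  obtain ⟨p, hp⟩ := h
  induction p with
  | nil => exact .inl (.refl ⟨hp _ (by simp), hx⟩)
  | @cons u v w hadj p ih =>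
    simp only [Walk.support_cons, List.mem_cons, forall_eq_or_imp] at hp
    by_cases hv : v ∈ Q
    · have huv : ConnIn G (S ∩ Q) u v :=
        .of_adj hadj ⟨hp.1, hx⟩ ⟨hp.2 _ p.start_mem_support, hv⟩
      rcases ih hv hp.2 with h | ⟨a, b, hab, h⟩
      · exact .inl (huv.trans h)
      · exact .inr ⟨a, b, huv.trans hab, h⟩
    · exact .inr ⟨u, v, .refl ⟨hp.1, hx⟩, hp.2 _ p.start_mem_support, hv, hadj⟩

theorem ConnIn.exit (h : ConnIn G S x y) (hx : x ∈ Q) (hy : y ∉ Q) :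
    ∃ a b, ConnIn G (S ∩ Q) x a ∧ b ∈ S ∧ b ∉ Q ∧ G.Adj a b :=
  (h.inter_or_exit hx).resolve_left fun h => hy h.mem_right.2

theorem ConnIn.inter_of_closed (h : ConnIn G S x y) (hx : x ∈ Q)
    (hQ : ∀ a ∈ Q, ∀ b ∈ S, G.Adj a b → b ∈ Q) : ConnIn G (S ∩ Q) x y :=
  (h.inter_or_exit hx).resolve_right fun ⟨_, _, h1, h2, h3, h4⟩ =>
    h3 (hQ _ h1.mem_right.2 _ h2 h4)

theorem IsConnSet.subset_of_closed (h : IsConnSet G S) (hx : x ∈ S) (hxQ : x ∈ Q)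
    (hQ : ∀ a ∈ Q, ∀ b ∈ S, G.Adj a b → b ∈ Q) : S ⊆ Q :=
  fun y hy => ((h.2 x hx y hy).inter_of_closed hxQ hQ).mem_right.2

theorem IsConnSet.of_center (hx : x ∈ S) (h : ∀ y ∈ S, ConnIn G S y x) : IsConnSet G S :=
  ⟨⟨x, hx⟩, fun y hy z hz => (h y hy).trans (h z hz).symm⟩

theorem IsConnSet.singleton (G : SimpleGraph V) (x : V) : IsConnSet G {x} :=
  .of_center rfl fun _ hy => hy ▸ .refl rfl

end ConnIn

/-! ### Neighbourhoods, components and hulls -/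

section Components

variable {V : Type u} {G : SimpleGraph V}

/-- The open neighbourhood of a vertex set. -/
def nbr (G : SimpleGraph V) (S : Set V) : Set V := {y | y ∉ S ∧ ∃ z ∈ S, G.Adj z y}

/-- `K` is the vertex set of a component of `G[S]`. -/
structure IsComp (G : SimpleGraph V) (S K : Set V) : Prop where
  conn : IsConnSet G K
  sub : K ⊆ S
  closed : ∀ x ∈ K, ∀ y ∈ S, G.Adj x y → y ∈ K

variable {S K K' U : Set V} {x v₀ : V}

theorem exists_isComp (hx : x ∈ S) : ∃ K, IsComp G S K ∧ x ∈ K := by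
  have key : ∀ y, ConnIn G S x y → ConnIn G {y | ConnIn G S x y} x y := fun y hy =>
    (hy.inter_of_closed (Q := {y | ConnIn G S x y}) (.refl hx) fun a ha b hb hab =>
      ha.trans (.of_adj hab ha.mem_right hb)).mono Set.inter_subset_right
  exact ⟨{y | ConnIn G S x y}, ⟨.of_center (ConnIn.refl hx) fun y hy => (key y hy).symm,
    fun y hy => hy.mem_right, fun y hy z hz h => hy.trans (.of_adj h hy.mem_right hz)⟩, .refl hx⟩

theorem IsComp.subset_of_mem (h : IsComp G S K) (hK' : IsConnSet G K') (hS : K' ⊆ S)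
    (hx : x ∈ K) (hx' : x ∈ K') : K' ⊆ K :=
  hK'.subset_of_closed hx' hx fun a ha b hb hab => h.closed a ha b (hS hb) hab

theorem IsComp.eq_of_mem (h : IsComp G S K) (h' : IsComp G S K') (hx : x ∈ K) (hx' : x ∈ K') :
    K = K' :=
  (h'.subset_of_mem h.conn h.sub hx' hx).antisymm (h.subset_of_mem h'.conn h'.sub hx hx')

theorem IsComp.not_mem_of_mem_nbr (h : IsComp G S K) (hx : x ∈ nbr G K) : x ∉ S := by
  obtain ⟨hxK, z, hz, hzx⟩ := hx
  exact fun hxS => hxK (h.closed z hz x hxS hzx)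

theorem IsComp.nbr_subset {C X : Set V} (h : IsComp G (C \ X) K) (hC : nbr G C ⊆ X) :
    nbr G K ⊆ X := by
  intro y hy
  have h1 := h.not_mem_of_mem_nbr hy
  obtain ⟨-, z, hz, hzy⟩ := hy
  by_contra hyX
  exact hyX (hC ⟨fun hyC => h1 ⟨hyC, hyX⟩, z, (h.sub hz).1, hzy⟩)

theorem isConnSet_union_nbr (h : IsConnSet G K) : IsConnSet G (K ∪ nbr G K) := by
  obtain ⟨⟨x, hx⟩, hK⟩ := h
  refine .of_center (.inl hx) fun y hy => ?_
  rcases hy with hy | ⟨hy, z, hz, hzy⟩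
  · exact (hK y hy x hx).mono Set.subset_union_left
  · exact (ConnIn.of_adj hzy.symm (.inr ⟨hy, z, hz, hzy⟩) (.inl hz)).trans
      ((hK z hz x hx).mono Set.subset_union_left)

/-- The vertices of `U` that `K` separates from `v₀`, together with `K`. -/
def hull (G : SimpleGraph V) (U : Set V) (v₀ : V) (K : Set V) : Set V :=
  {v | v ∈ U ∧ ¬ ConnIn G Kᶜ v v₀}

theorem subset_hull (h : K ⊆ U) : K ⊆ hull G U v₀ K :=
  fun _ hx => ⟨h hx, fun hc => hc.mem_left hx⟩

theorem hull_mono (h : K ⊆ K') : hull G U v₀ K ⊆ hull G U v₀ K' :=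
  fun _ hx => ⟨hx.1, fun hc => hx.2 (hc.mono (Set.compl_subset_compl.2 h))⟩

theorem hull_hull : hull G U v₀ (hull G U v₀ K) ⊆ hull G U v₀ K := by
  rintro v ⟨hv, hc⟩
  refine ⟨hv, fun h => hc ?_⟩
  refine (h.symm.inter_of_closed (Q := {w | ConnIn G Kᶜ w v₀}) (.refl h.mem_right)
    fun a ha b hb hab => ?_).symm.mono fun w hw hw' => hw'.2 hw.2
  exact (ConnIn.of_adj hab.symm hb ha.mem_left).trans ha

theorem hull_isConnSet (hU : IsConnSet G U) (hK : IsConnSet G K) (hKU : K ⊆ U) :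
    IsConnSet G (hull G U v₀ K) := by
  obtain ⟨x, hx⟩ := hK.1
  refine .of_center (subset_hull hKU hx) fun y hy => ?_
  by_cases hyK : y ∈ K
  · exact (hK.2 y hyK x hx).mono (subset_hull hKU)
  obtain ⟨a, b, hya, hbU, hbK, hab⟩ :=
    (hU.2 y hy.1 x (hKU hx)).exit (Q := Kᶜ) hyK (fun h => h hx)
  have hsub : ConnIn G (hull G U v₀ K) y a := by
    refine (hya.inter_of_closed (Q := hull G U v₀ K \ K) ⟨hy, hyK⟩
      fun c hc d hd hcd => ⟨⟨hd.1, fun h => ?_⟩, hd.2⟩).mono fun w hw => hw.2.1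
    exact hc.1.2 ((ConnIn.of_adj hcd hc.2 hd.2).trans h)
  have hbK : b ∈ K := not_not.1 hbK
  exact hsub.trans ((ConnIn.of_adj hab hsub.mem_right (subset_hull hKU hbK)).trans
    ((hK.2 b hbK x hx).mono (subset_hull hKU)))

theorem nbr_hull_subset (hU : ∀ x ∈ U, ∀ y, G.Adj x y → y ∈ U) (hKU : K ⊆ U) :
    nbr G (hull G U v₀ K) ⊆ nbr G K := by
  rintro y ⟨hy, z, hz, hzy⟩
  have hyU := hU z hz.1 y hzy
  have hyK : y ∉ K := fun h => hy (subset_hull hKU h)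
  have hyc : ConnIn G Kᶜ y v₀ := by
    by_contra h
    exact hy ⟨hyU, h⟩
  refine ⟨hyK, z, ?_, hzy⟩
  by_contra hzK
  exact hz.2 ((ConnIn.of_adj hzy hzK hyK).trans hyc)

end Components
/-! ### Positions of the search game -/

section Positions

variable {V ι : Type u} {G : SimpleGraph V} {T : SimpleGraph ι}

theorem TreeDecomp.connIn_bags (td : TreeDecomp G T) {v : V} {t₁ t₂ : ι} (h₁ : v ∈ td.bag t₁)
    (h₂ : v ∈ td.bag t₂) : ConnIn T {t | v ∈ td.bag t} t₁ t₂ := by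
  obtain ⟨p, hp⟩ := (td.isTree.connected.preconnected t₁ t₂).exists_isPath
  exact ⟨p, fun t ht => td.bag_sep p hp t ht ⟨h₁, h₂⟩⟩

theorem TreeDecomp.connIn_meeting (td : TreeDecomp G T) {D : Set V} {x y : V}
    (h : ConnIn G D x y) {t₁ t₂ : ι} (h₁ : x ∈ td.bag t₁) (h₂ : y ∈ td.bag t₂) :
    ConnIn T {t | (td.bag t ∩ D).Nonempty} t₁ t₂ := by
  obtain ⟨p, hp⟩ := h
  induction p generalizing t₁ with
  | nil => exact (td.connIn_bags h₁ h₂).mono fun t ht => ⟨_, ht, hp _ (by simp)⟩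
  | @cons u v w hadj p ih =>
    simp only [Walk.support_cons, List.mem_cons, forall_eq_or_imp] at hp
    obtain ⟨s, hus, hvs⟩ := td.exists_bag_adj hadj
    have hub : {t | u ∈ td.bag t} ⊆ {t | (td.bag t ∩ D).Nonempty} := fun t ht => ⟨u, ht, hp.1⟩
    exact ((td.connIn_bags h₁ hus).mono hub).trans (ih hvs h₂ hp.2)

theorem TreeDecomp.exists_bag_meeting (td : TreeDecomp G T) {D : Set V} (hD : IsConnSet G D)
    {t₀ : ι} (ht₀ : nbr G D ⊆ td.bag t₀) :
    ∃ t, nbr G D ⊆ td.bag t ∧ (td.bag t ∩ D).Nonempty := by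
  classical
  obtain ⟨d, hd⟩ := hD.1
  obtain ⟨s, hs⟩ := td.exists_bag d
  obtain ⟨p⟩ := td.isTree.connected.preconnected t₀ s
  suffices ∀ p : T.Walk t₀ s, p.IsPath → ∃ t, nbr G D ⊆ td.bag t ∧ (td.bag t ∩ D).Nonempty from
    this p.bypass p.bypass_isPath
  intro p hp
  clear * - hp hs hd hD ht₀
  induction p with
  | nil => exact ⟨_, ht₀, d, hs, hd⟩
  | @cons t₀ t₁ s hadj p ih =>
    by_cases hmeet : (td.bag t₀ ∩ D).Nonempty
    · exact ⟨t₀, ht₀, hmeet⟩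
    rw [Walk.cons_isPath_iff] at hp
    refine ih (fun y hy => ?_) hs hp.1
    obtain ⟨z, hz, hzy⟩ := hy.2
    obtain ⟨s', hzs', hys'⟩ := td.exists_bag_adj hzy
    obtain ⟨q, hq⟩ := td.connIn_meeting (hD.2 d hd z hz) hs hzs'
    have hnot : t₀ ∉ (p.append q).bypass.support := fun h => by
      have := Walk.support_bypass_subset_support _ h
      rw [Walk.mem_support_append_iff] at this
      exact this.elim hp.2 fun h => hmeet (hq _ h)
    refine td.bag_sep (.cons hadj (p.append q).bypass)
      ((Walk.cons_isPath_iff _ _).2 ⟨Walk.bypass_isPath _, hnot⟩) t₁ (by simp) ⟨ht₀ hy, hys'⟩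

/-- A vertex set that the search can reach: it is connected, its complement in `U` is
connected (and contains `v₀`), and its neighbourhood lies in a bag. -/
structure IsPosition (td : TreeDecomp G T) (U : Set V) (v₀ : V) (C : Set V) : Prop where
  conn : IsConnSet G C
  sub : C ⊆ U
  hull_sub : hull G U v₀ C ⊆ C
  base : v₀ ∉ C
  bag : ∃ t, nbr G C ⊆ td.bag t

variable {td : TreeDecomp G T} {U : Set V} {v₀ : V} {C : Set V}

theorem IsPosition.connIn_compl (hC : IsPosition td U v₀ C) {v : V} (hv : v ∈ U) (hvC : v ∉ C) :
    ConnIn G Cᶜ v v₀ := by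
  by_contra h
  exact hvC (hC.hull_sub ⟨hv, h⟩)

theorem IsPosition.hull_subset (hC : IsPosition td U v₀ C) {K : Set V} (hK : K ⊆ C) :
    hull G U v₀ K ⊆ C := (hull_mono hK).trans hC.hull_sub

theorem IsPosition.nbr_nonempty (hU : IsConnSet G U) (hv₀ : v₀ ∈ U)
    (hC : IsPosition td U v₀ C) : (nbr G C).Nonempty := by
  obtain ⟨x, hx⟩ := hC.conn.1
  obtain ⟨a, b, ha, -, hb, hab⟩ := (hU.2 x (hC.sub hx) v₀ hv₀).exit hx hC.base
  exact ⟨b, hb, a, ha.mem_right.2, hab⟩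

/-- The vertices of `B` in `C ∪ N(C)` not hidden behind a component of `C \ B`. -/
def frontBag (G : SimpleGraph V) (U : Set V) (v₀ : V) (C B : Set V) : Set V :=
  {x | x ∈ B ∧ x ∈ C ∪ nbr G C ∧ ∀ K, IsComp G (C \ B) K → x ∉ hull G U v₀ K}

theorem IsPosition.isComp_frontBag [Finite V] (hU : IsConnSet G U)
    (hU' : ∀ x ∈ U, ∀ y, G.Adj x y → y ∈ U) (hC : IsPosition td U v₀ C) {t : ι}
    (ht : nbr G C ⊆ td.bag t) {D : Set V} (hD : IsComp G (C \ frontBag G U v₀ C (td.bag t)) D) :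
    ∃ K, IsComp G (C \ td.bag t) K ∧ D = hull G U v₀ K := by
  set X := frontBag G U v₀ C (td.bag t) with hX
  have hcov : ∀ d ∈ C \ X, ∃ K, IsComp G (C \ td.bag t) K ∧ d ∈ hull G U v₀ K := by
    intro d hd
    by_cases hdt : d ∈ td.bag t
    · by_contra! h
      exact hd.2 ⟨hdt, .inl hd.1, h⟩
    · obtain ⟨K, hK, hdK⟩ := exists_isComp (G := G) (S := C \ td.bag t) ⟨hd.1, hdt⟩
      exact ⟨K, hK, subset_hull ((hK.sub.trans Set.sdiff_subset).trans hC.sub) hdK⟩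
  obtain ⟨d, hd⟩ := hD.conn.1
  obtain ⟨K, ⟨hK, hdK⟩, hmax⟩ := (Set.toFinite
    {K | IsComp G (C \ td.bag t) K ∧ d ∈ hull G U v₀ K}).exists_maximalFor
      (fun K => hull G U v₀ K) _ (hcov d (hD.sub hd))
  have hKC : ∀ {K}, IsComp G (C \ td.bag t) K → K ⊆ C := fun h => h.sub.trans Set.sdiff_subset
  have hKU : ∀ {K}, IsComp G (C \ td.bag t) K → K ⊆ U := fun h => (hKC h).trans hC.sub
  refine ⟨K, hK, subset_antisymm ?_ ?_⟩
  · refine hD.conn.subset_of_closed hd hdK fun z hz y hy hzy => ?_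
    by_contra hyK
    obtain ⟨hyK', z, hzK, hzy⟩ := nbr_hull_subset (v₀ := v₀) hU' (hKU hK) ⟨hyK, z, hz, hzy⟩
    have hyt : y ∈ td.bag t := hK.nbr_subset ht ⟨hyK', z, hzK, hzy⟩
    obtain ⟨K₁, hK₁, hyK₁⟩ := hcov y (hD.sub hy)
    have hdisj : ∀ w ∈ K, w ∉ K₁ := fun w hw hw₁ => hyK (hK.eq_of_mem hK₁ hw hw₁ ▸ hyK₁)
    have hyn : y ∉ K₁ := fun h => (hK₁.sub h).2 hyt
    have hsub : K ⊆ hull G U v₀ K₁ := fun w hw => ⟨hKU hK hw, fun hc => hyK₁.2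
      ((ConnIn.of_adj hzy.symm hyn (hdisj z hzK)).trans
        (((hK.conn.2 z hzK w hw).mono hdisj).trans hc))⟩
    have hle : hull G U v₀ K ⊆ hull G U v₀ K₁ := (hull_mono hsub).trans hull_hull
    exact hyK (hmax ⟨hK₁, hle hdK⟩ hle hyK₁)
  · refine hD.subset_of_mem (hull_isConnSet hU hK.conn (hKU hK)) (fun x hx => ⟨?_, fun h => ?_⟩)
      hd hdK
    · exact hC.hull_subset (hKC hK) hx
    · exact h.2.2 K hK hx

theorem IsPosition.of_isComp_frontBag [Finite V] (hU : IsConnSet G U)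
    (hU' : ∀ x ∈ U, ∀ y, G.Adj x y → y ∈ U) (hC : IsPosition td U v₀ C) {t : ι}
    (ht : nbr G C ⊆ td.bag t) {D : Set V} (hD : IsComp G (C \ frontBag G U v₀ C (td.bag t)) D) :
    IsPosition td U v₀ D := by
  obtain ⟨K, hK, rfl⟩ := hC.isComp_frontBag hU hU' ht hD
  have hKC : K ⊆ C := hK.sub.trans Set.sdiff_subset
  have hsub := hC.hull_subset hKC
  exact ⟨hD.conn, hsub.trans hC.sub, hull_hull, fun h => hC.base (hsub h),
    t, (nbr_hull_subset hU' (hKC.trans hC.sub)).trans (hK.nbr_subset ht)⟩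

theorem IsPosition.exists_frontBag_meeting [Finite V] (hU : IsConnSet G U)
    (hU' : ∀ x ∈ U, ∀ y, G.Adj x y → y ∈ U) (hv₀ : v₀ ∈ U) (hC : IsPosition td U v₀ C) :
    ∃ t, nbr G C ⊆ td.bag t ∧ (frontBag G U v₀ C (td.bag t) ∩ C).Nonempty := by
  obtain ⟨K, ⟨hK, hKC, hKh, t₀, hKt₀⟩, hmin⟩ := (Set.toFinite
    {K | IsConnSet G K ∧ K ⊆ C ∧ C = hull G U v₀ K ∧ ∃ t, nbr G K ⊆ td.bag t}).exists_minimal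
      ⟨C, hC.conn, subset_rfl, (subset_hull hC.sub).antisymm hC.hull_sub, hC.bag⟩
  obtain ⟨t, hKt, hmeet⟩ := td.exists_bag_meeting hK hKt₀
  have ht : nbr G C ⊆ td.bag t := by
    refine subset_trans ?_ hKt
    conv_lhs => rw [hKh]
    exact nbr_hull_subset hU' (hKC.trans hC.sub)
  refine ⟨t, ht, ?_⟩
  by_contra hne
  have hCX : C ⊆ C \ frontBag G U v₀ C (td.bag t) := fun x hx => ⟨hx, fun h => hne ⟨x, h, hx⟩⟩
  obtain ⟨K₁, hK₁, hCK₁⟩ := hC.isComp_frontBag hU hU' ht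
    ⟨hC.conn, hCX, fun _ _ y hy _ => hy.1⟩
  have hK₁C : K₁ ⊆ C := hK₁.sub.trans Set.sdiff_subset
  obtain ⟨w, hwt, hwK⟩ := hmeet
  suffices K₁ ⊆ K from (hK₁.sub (hmin ⟨hK₁.conn, hK₁C, hCK₁, t, hK₁.nbr_subset ht⟩ this hwK)).2 hwt
  have hclosed : ∀ a ∈ K, ∀ b ∈ K₁, G.Adj a b → b ∈ K := fun a ha b hb hab => by
    by_contra hbK
    exact (hK₁.sub hb).2 (hKt ⟨hbK, a, ha, hab⟩)
  suffices ∃ z ∈ K₁, z ∈ K by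
    obtain ⟨z, hz₁, hz⟩ := this
    exact hK₁.conn.subset_of_closed hz₁ hz hclosed
  obtain ⟨y, hy⟩ := hC.nbr_nonempty hU hv₀
  have hyU : y ∈ U := by
    obtain ⟨z, hz, hzy⟩ := hy.2
    exact hU' z (hC.sub hz) y hzy
  have hy₁ : y ∈ nbr G K₁ := by
    rw [hCK₁] at hy
    exact nbr_hull_subset hU' (hK₁C.trans hC.sub) hy
  obtain ⟨-, z, hz, hzy⟩ := hy₁
  refine ⟨z, hz, ?_⟩
  by_contra hzK
  have hzh : z ∈ hull G U v₀ K := hKh ▸ hK₁C hz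
  have hyh : y ∉ hull G U v₀ K := hKh ▸ hy.1
  refine hyh ⟨hyU, fun hc => hzh.2 ((ConnIn.of_adj hzy hzK hc.mem_left).trans hc)⟩

/-- From every position there is a bag leading only to smaller positions. -/
theorem IsPosition.exists_move [Finite V] (hU : IsConnSet G U)
    (hU' : ∀ x ∈ U, ∀ y, G.Adj x y → y ∈ U) (hv₀ : v₀ ∈ U) (hC : IsPosition td U v₀ C) {k : ℕ}
    (hk : ∀ t, (td.bag t).ncard ≤ k + 1) :
    ∃ X, nbr G C ⊆ X ∧ X ⊆ C ∪ nbr G C ∧ (X ∩ C).Nonempty ∧ X.ncard ≤ k + 1 ∧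
      ∀ D, IsComp G (C \ X) D → IsPosition td U v₀ D := by
  obtain ⟨t, ht, hmeet⟩ := hC.exists_frontBag_meeting hU hU' hv₀
  refine ⟨frontBag G U v₀ C (td.bag t), fun y hy => ⟨ht hy, .inr hy, fun K hK hyK => ?_⟩,
    fun x hx => hx.2.1, hmeet,
    (Set.ncard_le_ncard fun x hx => hx.1).trans (hk t),
    fun D hD => hC.of_isComp_frontBag hU hU' ht hD⟩
  exact hy.1 (hC.hull_subset (hK.sub.trans Set.sdiff_subset) hyK)

end Positions
/-! ### Short detours obtained from the cycle space -/

section Detour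

variable {V : Type u} {G : SimpleGraph V}

/-- The indicator, in `ZMod 2`, of the edges between `Z` and `C`. -/
noncomputable def crossing (Z C : Set V) (e : Sym2 V) : ZMod 2 := by
  classical exact if ∃ a ∈ Z, ∃ c ∈ C, e = s(a, c) then 1 else 0

/-- The parity of the number of edges of a walk between `Z` and `C`. -/
noncomputable def crossParity (Z C : Set V) {x y : V} (p : G.Walk x y) : ZMod 2 :=
  (p.edges.map (crossing Z C)).sum

variable {Z C : Set V} {a b : V}

theorem crossing_eq_one (ha : a ∈ Z) (hb : b ∈ C) : crossing Z C s(a, b) = 1 :=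
  if_pos ⟨a, ha, b, hb, rfl⟩

theorem crossing_eq_one' (ha : a ∈ C) (hb : b ∈ Z) : crossing Z C s(a, b) = 1 :=
  if_pos ⟨b, hb, a, ha, Sym2.eq_swap⟩

theorem crossing_eq_zero (h : ¬ (a ∈ Z ∧ b ∈ C)) (h' : ¬ (b ∈ Z ∧ a ∈ C)) :
    crossing Z C s(a, b) = 0 := by
  refine if_neg ?_
  rintro ⟨z, hz, c, hc, he⟩
  rw [Sym2.eq_iff] at he
  rcases he with ⟨rfl, rfl⟩ | ⟨rfl, rfl⟩
  · exact h ⟨hz, hc⟩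
  · exact h' ⟨hz, hc⟩

@[simp]
theorem crossParity_nil : crossParity Z C (.nil : G.Walk a a) = 0 := by simp [crossParity]

@[simp]
theorem crossParity_cons {c : V} (h : G.Adj a b) (p : G.Walk b c) :
    crossParity Z C (.cons h p) = crossing Z C s(a, b) + crossParity Z C p := by
  simp [crossParity]

@[simp]
theorem crossParity_append {c : V} (p : G.Walk a b) (q : G.Walk b c) :
    crossParity Z C (p.append q) = crossParity Z C p + crossParity Z C q := by
  simp [crossParity]

theorem crossParity_eq_zero (p : G.Walk a b)
    (h : (∀ v ∈ p.support, v ∉ Z) ∨ ∀ v ∈ p.support, v ∉ C) : crossParity Z C p = 0 := by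
  refine List.sum_eq_zero fun x hx => ?_
  obtain ⟨e, he, rfl⟩ := List.mem_map.1 hx
  induction e with
  | h u v =>
    have hu := p.fst_mem_support_of_mem_edges he
    have hv := p.snd_mem_support_of_mem_edges he
    rcases h with h | h
    · exact crossing_eq_zero (fun h' => h u hu h'.1) (fun h' => h v hv h'.1)
    · exact crossing_eq_zero (fun h' => h v hv h'.2) (fun h' => h u hu h'.2)

theorem sum_crossing_mul_walkChar [Fintype V] [Fintype (Sym2 V)] {p : G.Walk a b}
    (hp : p.edges.Nodup) : ∑ e, crossing Z C e * walkChar p e = crossParity Z C p := by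
  classical
  rw [crossParity, ← List.sum_toFinset _ hp]
  symm
  simp only [walkChar, mul_ite, mul_one, mul_zero]
  rw [← Finset.sum_filter]
  congr 1
  ext e
  simp

theorem exists_cycle_crossParity_ne_zero [Finite V] {ℓ : ℕ} (hℓ : GeneratesLE G ℓ) {v : V}
    {p : G.Walk v v} (hp : p.IsCycle) (h : crossParity Z C p ≠ 0) :
    ∃ (w : V) (c : G.Walk w w), c.IsCycle ∧ c.length ≤ ℓ ∧ crossParity Z C c ≠ 0 := by
  classical
  have := Fintype.ofFinite V
  by_contra! hall
  let φ : (Sym2 V → ZMod 2) →ₗ[ZMod 2] ZMod 2 := Fintype.linearCombination (ZMod 2) (crossing Z C)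
  have hφ : ∀ {w : V} {c : G.Walk w w}, c.IsCycle → φ (walkChar c) = crossParity Z C c := by
    intro w c hc
    rw [← sum_crossing_mul_walkChar hc.edges_nodup]
    simp [φ, Fintype.linearCombination_apply, mul_comm]
  have hle : Submodule.span (ZMod 2) (cycleChars G ℓ) ≤ LinearMap.ker φ := by
    rw [Submodule.span_le]
    rintro _ ⟨w, c, hc, hcl, rfl⟩
    exact (hφ hc).trans (hall w c hc hcl)
  exact h ((hφ hp).symm.trans (hle (hℓ p hp)))

/-- A walk starting in `C` and ending outside is split at its first exit from `C`. -/
theorem exists_first_exit (hZC : Disjoint Z C) {u v : V} (p : G.Walk u v) (hu : u ∈ C)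
    (hv : v ∉ C) :
    ∃ (z : V) (q : G.Walk u z) (b : G.Walk z v), z ∈ nbr G C ∧ q.length + b.length = p.length ∧
      (∀ w ∈ q.support, w ∈ C ∨ w = z) ∧
      (z ∈ Z ∧ crossParity Z C p = 1 + crossParity Z C b ∨
        z ∉ Z ∧ crossParity Z C p = crossParity Z C b) := by
  induction p with
  | nil => exact absurd hu hv
  | @cons u w v hadj p ih =>
    by_cases hw : w ∈ C
    · obtain ⟨z, q, b, hz, hlen, hsupp, hpar⟩ := ih hw hv
      refine ⟨z, .cons hadj q, b, hz, by simp only [Walk.length_cons]; omega, ?_, ?_⟩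
      · simpa using ⟨.inl hu, hsupp⟩
      · rw [crossParity_cons, crossing_eq_zero (fun h => hZC.notMem_of_mem_left h.1 hu)
          (fun h => hZC.notMem_of_mem_left h.1 hw), zero_add]
        exact hpar
    · refine ⟨w, .cons hadj .nil, p, ⟨hw, u, hu, hadj⟩, by simp [add_comm], by simp [hu], ?_⟩
      rw [crossParity_cons]
      by_cases hwZ : w ∈ Z
      · exact .inl ⟨hwZ, by rw [crossing_eq_one' hu hwZ]⟩
      · exact .inr ⟨hwZ, by rw [crossing_eq_zero (fun h => hw h.2) (fun h => hwZ h.1), zero_add]⟩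

/-- A walk with odd parity and both ends outside `C` has a segment through `C` with exactly
one end in `Z`. -/
theorem exists_crossing_segment (hZC : Disjoint Z C) (n : ℕ) {u v : V} (p : G.Walk u v)
    (hn : p.length ≤ n) (hu : u ∉ C) (hv : v ∉ C) (hp : crossParity Z C p ≠ 0) :
    ∃ (x y : V) (a : G.Walk u x) (q : G.Walk x y) (b : G.Walk y v),
      a.length + q.length + b.length = p.length ∧ (∀ w ∈ q.support, w ∈ C ∨ w = x ∨ w = y) ∧
      x ∈ nbr G C ∧ y ∈ nbr G C ∧ (x ∈ Z ∧ y ∉ Z ∨ x ∉ Z ∧ y ∈ Z) := by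
  induction n generalizing u with
  | zero =>
    cases p with
    | nil => simp at hp
    | cons => simp at hn
  | succ n ih =>
    cases p with
    | nil => simp at hp
    | @cons _ w _ hadj p =>
      simp only [Walk.length_cons] at hn
      by_cases hw : w ∈ C
      · obtain ⟨z, q, b, hz, hlen, hsupp, hpar⟩ := exists_first_exit hZC p hw hv
        have hun : u ∈ nbr G C := ⟨hu, w, hw, hadj.symm⟩
        by_cases hsep : u ∈ Z ∧ z ∉ Z ∨ u ∉ Z ∧ z ∈ Z
        · refine ⟨u, z, .nil, .cons hadj q, b, by simp only [Walk.length_cons, Walk.length_nil]; omega,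
            ?_, hun, hz, hsep⟩
          simp only [Walk.support_cons, List.mem_cons, forall_eq_or_imp, true_or, or_true,
            true_and]
          exact fun w hw => (hsupp w hw).imp_right .inr
        · have hb : crossParity Z C b ≠ 0 := by
            rw [crossParity_cons] at hp
            by_cases huZ : u ∈ Z
            · have hzZ : z ∈ Z := by tauto
              rw [crossing_eq_one huZ hw] at hp
              rcases hpar with ⟨-, h⟩ | ⟨h, -⟩
              · rw [h, ← add_assoc, CharTwo.add_self_eq_zero, zero_add] at hp
                exact hp
              · exact absurd hzZ h
            · have hzZ : z ∉ Z := by tauto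
              rw [crossing_eq_zero (fun h => huZ h.1) (fun h => hu h.2)] at hp
              rcases hpar with ⟨h, -⟩ | ⟨-, h⟩
              · exact absurd h hzZ
              · rwa [h, zero_add] at hp
          obtain ⟨x, y, a, q', b', hlen', h⟩ := ih b (by omega) hz.1 hb
          exact ⟨x, y, .cons hadj (q.append a), q', b',
            by simp only [Walk.length_cons, Walk.length_append]; omega, h⟩
      · have hp' : crossParity Z C p ≠ 0 := by
          rwa [crossParity_cons, crossing_eq_zero (fun h => hw h.2) (fun h => hu h.2),
            zero_add] at hp
        obtain ⟨x, y, a, q, b, hlen, h⟩ := ih p (by omega) hw hp'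
        exact ⟨x, y, .cons hadj a, q, b, by simp only [Walk.length_cons]; omega, h⟩

theorem exists_isPath_of_connIn {S : Set V} (h : ConnIn G S a b) :
    ∃ p : G.Walk a b, p.IsPath ∧ ∀ v ∈ p.support, v ∈ S := by
  classical
  obtain ⟨p, hp⟩ := h
  exact ⟨p.bypass, p.bypass_isPath, fun v hv => hp v (p.support_bypass_subset_support hv)⟩

/-- Two non-adjacent neighbours of a connected set that are also joined outside it lie on a
cycle crossing its boundary once at the first of them. -/
theorem exists_cycle_through (hZC : Disjoint Z C) (hC : IsConnSet G C) {z z' : V}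
    (hz : z ∈ nbr G C) (hz' : z' ∈ nbr G C) (hzZ : z ∈ Z) (hz'Z : z' ∉ Z)
    (h : ConnIn G Cᶜ z z') :
    ∃ (v : V) (c : G.Walk v v), c.IsCycle ∧ crossParity Z C c ≠ 0 := by
  obtain ⟨q, hq, hqC⟩ := exists_isPath_of_connIn h
  obtain ⟨hzC, c, hc, hcz⟩ := hz
  obtain ⟨hzC', c', hc', hcz'⟩ := hz'
  obtain ⟨p, hp, hpC⟩ := exists_isPath_of_connIn (hC.2 c' hc' c hc)
  have hpath : (q.append (.cons hcz'.symm p)).IsPath := by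
    rw [Walk.isPath_def, Walk.support_append, Walk.support_cons, List.tail_cons]
    exact hq.support_nodup.append hp.support_nodup fun v hv hv' => hqC v hv (hpC v hv')
  refine ⟨c, .cons hcz (q.append (.cons hcz'.symm p)), ?_, ?_⟩
  · refine (Walk.cons_isCycle_iff _ _).2 ⟨hpath, ?_⟩
    rw [Walk.edges_append, Walk.edges_cons, List.mem_append, List.mem_cons]
    rintro (he | he | he)
    · exact hqC _ (q.fst_mem_support_of_mem_edges he) hc
    · rw [Sym2.eq_iff] at he
      rcases he with ⟨rfl, -⟩ | ⟨-, rfl⟩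
      · exact hzC' hc
      · exact hz'Z hzZ
    · exact hzC (hpC _ (p.snd_mem_support_of_mem_edges he))
  · rw [crossParity_cons, crossParity_append, crossParity_cons, crossing_eq_one' hc hzZ,
      crossParity_eq_zero q (.inr hqC),
      crossParity_eq_zero p (.inl fun v hv hvZ => hZC.notMem_of_mem_left hvZ (hpC v hv)),
      crossing_eq_zero (fun h => hz'Z h.1) (fun h => hzC' h.2)]
    simp

theorem exists_short_detour [Finite V] {ℓ : ℕ} (hℓ : GeneratesLE G ℓ) {Z' : Set V}
    (hZC : Disjoint Z C) (hZZ' : Disjoint Z Z') (hadj : ∀ x ∈ Z, ∀ y ∈ Z', ¬ G.Adj x y)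
    (hC : IsConnSet G C) (hN : nbr G C ⊆ Z ∪ Z') {z z' : V} (hz : z ∈ nbr G C)
    (hz' : z' ∈ nbr G C) (hzZ : z ∈ Z) (hz'Z : z' ∈ Z') (h : ConnIn G Cᶜ z z') :
    ∃ x ∈ Z, ∃ y ∈ Z', ∃ q : G.Walk x y, q.IsPath ∧ q.length + 2 ≤ ℓ ∧
      ∀ w ∈ q.support, w ∈ C ∨ w = x ∨ w = y := by
  classical
  obtain ⟨v, c, hc, hodd⟩ :=
    exists_cycle_through hZC hC hz hz' hzZ (hZZ'.notMem_of_mem_right hz'Z) h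
  obtain ⟨w, c, -, hlen, hodd⟩ := exists_cycle_crossParity_ne_zero hℓ hc hodd
  have hex : ∃ u ∈ c.support, u ∉ C := by
    by_contra! hall
    exact hodd (crossParity_eq_zero c
      (.inl fun v hv hvZ => hZC.notMem_of_mem_left hvZ (hall v hv)))
  obtain ⟨u, hu, huC⟩ := hex
  have hodd' : crossParity Z C (c.rotate u hu) ≠ 0 := by
    rwa [crossParity, ((c.rotate_edges u hu).perm.map _).sum_eq]
  obtain ⟨x, y, a, q, b, hsum, hsupp, hx, hy, hxy⟩ :=
    exists_crossing_segment hZC _ _ le_rfl huC huC hodd'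
  rw [Walk.length_rotate] at hsum
  have hlong : ∀ {s t : V}, s ∈ Z → t ∈ Z' → ∀ r : G.Walk s t, 2 ≤ r.length := by
    intro s t hs ht r
    by_contra! hlt
    interval_cases hr : r.length
    · exact hZZ'.notMem_of_mem_left (Walk.eq_of_length_eq_zero hr ▸ hs) ht
    · exact hadj s hs t ht (Walk.adj_of_length_eq_one hr)
  have hZ' : ∀ {s}, s ∈ nbr G C → s ∉ Z → s ∈ Z' := fun h h' => (hN h).resolve_left h'
  have hab : (b.append a).length = b.length + a.length := Walk.length_append ..
  have hqb := q.length_bypass_le_length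
  rcases hxy with ⟨hxZ, hyZ⟩ | ⟨hxZ, hyZ⟩
  · have := hlong hxZ (hZ' hy hyZ) (b.append a).reverse
    rw [Walk.length_reverse] at this
    exact ⟨x, hxZ, y, hZ' hy hyZ, q.bypass, q.bypass_isPath, by omega,
      fun w hw => hsupp w (q.support_bypass_subset_support hw)⟩
  · have := hlong hyZ (hZ' hx hxZ) (b.append a)
    refine ⟨y, hyZ, x, hZ' hx hxZ, q.bypass.reverse, q.bypass_isPath.reverse,
      by rw [Walk.length_reverse]; omega, fun w hw => ?_⟩
    rw [Walk.support_reverse, List.mem_reverse] at hw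
    exact (hsupp w (q.support_bypass_subset_support hw)).imp_right Or.symm

end Detour

/-! ### The potential controlling the size of the parts -/

section Budget

variable {V : Type u} {G : SimpleGraph V} {j k : ℕ} {X R Z D : Set V}

/-- The potential of a partially filled part `R` with respect to a bag `X`: every vertex of
`X` not yet in `R` counts `j + 1`, every vertex of `R` counts `1` and every component of `G[R]`
counts `j`. -/
def Budget (G : SimpleGraph V) (j k : ℕ) (X R : Set V) : Prop :=
  ∃ Rep ⊆ R, (∀ v ∈ R, ∃ d ∈ Rep, ConnIn G R v d) ∧
    (X \ R).ncard * (j + 1) + R.ncard + j * Rep.ncard ≤ (k + 1) * (j + 1)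

theorem Budget.empty (hX : X.ncard ≤ k + 1) : Budget G j k X ∅ := by
  refine ⟨∅, subset_rfl, by simp, ?_⟩
  simpa using Nat.mul_le_mul_right (j + 1) hX

theorem Budget.ncard_le [Finite V] (h : Budget G j k X R) (hR : R.Nonempty) :
    R.ncard ≤ k * (j + 1) + 1 := by
  obtain ⟨Rep, -, hconn, hle⟩ := h
  obtain ⟨v, hv⟩ := hR
  obtain ⟨d, hd, -⟩ := hconn v hv
  have h1 : 0 < Rep.ncard := (Set.ncard_pos).2 ⟨d, hd⟩
  nlinarith

theorem Budget.union [Finite V] (h : Budget G j k X R) {M : Set V} (hM : M ⊆ X) :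
    Budget G j k X (R ∪ M) := by
  wlog hd : Disjoint R M generalizing M
  · simpa using this (Set.sdiff_subset.trans hM) (Set.disjoint_sdiff_right (s := R) (t := M))
  obtain ⟨Rep, hRep, hconn, hle⟩ := h
  refine ⟨Rep ∪ M, Set.union_subset_union_left _ hRep, ?_, ?_⟩
  · rintro v (hv | hv)
    · obtain ⟨d, hd, hvd⟩ := hconn v hv
      exact ⟨d, .inl hd, hvd.mono Set.subset_union_left⟩
    · exact ⟨v, .inr hv, .refl (.inr hv)⟩
  · have h1 : (X \ (R ∪ M)).ncard + M.ncard = (X \ R).ncard := by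
      rw [← Set.sdiff_sdiff]
      exact Set.ncard_sdiff_add_ncard_of_subset
        fun x hx => ⟨hM hx, fun hxR => hd.notMem_of_mem_left hxR hx⟩
    have h2 := Set.ncard_union_le R M
    have h3 := Set.ncard_union_le Rep M
    rw [← h1] at hle
    nlinarith [Nat.mul_le_mul_left j h3]

theorem SimpleGraph.Walk.IsPath.eq_of_mem_takeUntil_dropUntil [DecidableEq V] {x y p a : V}
    {P : G.Walk x y} (hP : P.IsPath) (hp : p ∈ P.support) (h1 : a ∈ (P.takeUntil p hp).support)
    (h2 : a ∈ (P.dropUntil p hp).support) : a = p := by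
  have hnd := hP.support_nodup
  rw [← P.take_spec hp, Walk.support_append, List.nodup_append] at hnd
  rw [Walk.mem_support_iff] at h2
  exact h2.resolve_right fun h => hnd.2.2 a h1 a h rfl

/-- Adding a short path joining two components does not increase the potential. -/
theorem Budget.union_path [Finite V] (h : Budget G j k X (Z ∩ (D ∪ nbr G D)))
    (hX : X ⊆ D ∪ nbr G D) (hD : nbr G D ⊆ X) {x y : V} (P : G.Walk x y) (hP : P.IsPath)
    (hx : x ∈ Z) (hy : y ∈ Z) (hPZ : ∀ v ∈ P.support, v ∈ Z → v = x ∨ v = y)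
    (hxy : ¬ ConnIn G Z x y) (hlen : P.length ≤ j + 1) :
    Budget G j k X ((Z ∪ {v | v ∈ P.support}) ∩ (D ∪ nbr G D)) := by
  classical
  set A := D ∪ nbr G D with hA
  set R := Z ∩ A with hR
  set S : Set V := {v | v ∈ P.support} with hS
  set M := (S ∩ X) \ R with hM
  set N := (S ∩ A) \ (R ∪ X) with hN
  have hsplit : (Z ∪ S) ∩ A = (R ∪ M) ∪ N := by
    ext v
    have := @hX v
    simp only [hR, hM, hN, Set.mem_inter_iff, Set.mem_union, Set.mem_sdiff]
    tauto
  have hUM := h.union (M := M) fun v hv => hv.1.2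
  rcases N.eq_empty_or_nonempty with hN0 | ⟨p, hp⟩
  · rw [hsplit, hN0, Set.union_empty]; exact hUM
  obtain ⟨Rep, hRep, hconn, hle⟩ := h
  set R' := (Z ∪ S) ∩ A with hR'
  have hRR' : R ⊆ R' := fun v hv => ⟨.inl hv.1, hv.2⟩
  have hMR' : M ⊆ R' := fun v hv => ⟨.inr hv.1.1, hX hv.1.2⟩
  set Q := D \ (R ∪ X) with hQ
  have hNQ : N ⊆ Q := by
    rintro v ⟨⟨-, hvD | hvD⟩, hv⟩
    · exact ⟨hvD, hv⟩
    · exact (hv (.inr (hD hvD))).elim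
  have hQA : ∀ a ∈ Q, ∀ b, b ∉ Q → G.Adj a b → b ∈ A ∧ b ∈ R ∪ X := by
    intro a ha b hb hab
    by_cases hbD : b ∈ D
    · exact ⟨.inl hbD, by_contra fun h => hb ⟨hbD, h⟩⟩
    · have : b ∈ nbr G D := ⟨hbD, a, ha.1, hab⟩
      exact ⟨.inr this, .inr (hD this)⟩
  have hZQ : ∀ z ∈ Z, z ∉ Q := fun z hz hzQ => hzQ.2 (.inl ⟨hz, .inl hzQ.1⟩)
  have hexit : ∀ {S' : Set V} {v z : V}, S' ⊆ S → v ∈ N → z ∈ Z → ConnIn G S' v z →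
      ∃ b ∈ S', b ∉ Q ∧ b ∈ R ∪ M ∧ ConnIn G R' v b := by
    intro S' v z hS' hv hz hvz
    obtain ⟨a, b, ha, hb, hbQ, hab⟩ := hvz.exit (hNQ hv) (hZQ z hz)
    obtain ⟨hbA, hbRX⟩ := hQA a ha.mem_right.2 b hbQ hab
    have hb' : b ∈ R' := ⟨.inr (hS' hb), hbA⟩
    have ha' : ConnIn G R' v a := ha.mono fun w hw => ⟨.inr (hS' hw.1), .inl hw.2.1⟩
    refine ⟨b, hb, hbQ, ?_, ha'.trans (.of_adj hab ha'.mem_right hb')⟩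
    by_cases hbR : b ∈ R
    · exact .inl hbR
    · exact .inr ⟨⟨hS' hb, hbRX.resolve_left hbR⟩, hbR⟩
  have hrep : ∀ c ∈ R ∪ M, ∃ d ∈ Rep ∪ M, ConnIn G R' c d ∧
      ((c ∈ R ∧ d ∈ R ∧ ConnIn G R c d) ∨ (c ∉ R ∧ d = c)) := by
    rintro c (hc | hc)
    · obtain ⟨d, hd, hcd⟩ := hconn c hc
      exact ⟨d, .inl hd, hcd.mono hRR', .inl ⟨hc, hRep hd, hcd⟩⟩
    · exact ⟨c, .inr hc, .refl (hMR' hc), .inr ⟨hc.2, rfl⟩⟩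
  have hpS : p ∈ P.support := hp.1.1
  obtain ⟨a, haS, haQ, haRM, hpa⟩ := hexit (S' := {v | v ∈ (P.takeUntil p hpS).support})
    (fun v hv => P.support_takeUntil_subset_support hpS hv) hp hx
    (ConnIn.of_walk (P.takeUntil p hpS)).symm
  obtain ⟨b, hbS, hbQ, hbRM, hpb⟩ := hexit (S' := {v | v ∈ (P.dropUntil p hpS).support})
    (fun v hv => P.support_dropUntil_subset_support hpS hv) hp hy
    (ConnIn.of_walk (P.dropUntil p hpS))
  have hab : a ≠ b := by
    rintro rfl
    exact haQ (hP.eq_of_mem_takeUntil_dropUntil hpS haS hbS ▸ hNQ hp)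
  obtain ⟨da, hda, hada, ha⟩ := hrep a haRM
  obtain ⟨db, hdb, hbdb, hb⟩ := hrep b hbRM
  have hdab : da ≠ db := by
    rintro rfl
    rcases ha with ⟨haR, hdR, had⟩ | ⟨haR, rfl⟩ <;> rcases hb with ⟨hbR, hdR', hbd⟩ | ⟨hbR, hbd⟩
    · have hcon : ConnIn G Z a b := (had.trans hbd.symm).mono Set.inter_subset_left
      rcases hPZ a (P.support_takeUntil_subset_support hpS haS) haR.1 with rfl | rfl <;>
      rcases hPZ b (P.support_dropUntil_subset_support hpS hbS) hbR.1 with rfl | rfl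
      · exact hab rfl
      · exact hxy hcon
      · exact hxy hcon.symm
      · exact hab rfl
    · exact hbR (hbd ▸ hdR)
    · exact haR hdR'
    · exact hab hbd
  have hdab' : ConnIn G R' db da := hbdb.symm.trans (hpb.symm.trans (hpa.trans hada))
  have hall : ∀ v ∈ R', ∃ d ∈ Rep ∪ M, ConnIn G R' v d := by
    have hRM : ∀ v ∈ R ∪ M, ∃ d ∈ Rep ∪ M, ConnIn G R' v d := fun v hv => by
      obtain ⟨d, hd, hvd, -⟩ := hrep v hv
      exact ⟨d, hd, hvd⟩
    intro v hv
    rcases hsplit.subset hv with hv | hv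
    · exact hRM v hv
    · have hvS : v ∈ P.support := hv.1.1
      obtain ⟨c, -, -, hc, hvc⟩ := hexit (S' := {v' | v' ∈ (P.dropUntil v hvS).support})
        (fun w hw => P.support_dropUntil_subset_support hvS hw) hv hy (ConnIn.of_walk _)
      obtain ⟨d, hd, hcd⟩ := hRM c hc
      exact ⟨d, hd, hvc.trans hcd⟩
  refine ⟨(Rep ∪ M) \ {db}, ?_, fun v hv => ?_, ?_⟩
  · exact Set.sdiff_subset.trans (Set.union_subset (hRep.trans hRR') hMR')
  · obtain ⟨d, hd, hvd⟩ := hall v hv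
    by_cases hddb : d = db
    · subst hddb
      exact ⟨da, ⟨hda, hdab⟩, hvd.trans hdab'⟩
    · exact ⟨d, ⟨hd, hddb⟩, hvd⟩
  · have h1 : (X \ R').ncard + M.ncard = (X \ R).ncard := by
      have : X \ R' = (X \ R) \ M := by
        ext v
        have := @hX v
        simp only [hR', hR, hM, Set.mem_inter_iff, Set.mem_union, Set.mem_sdiff]
        tauto
      rw [this]
      exact Set.ncard_sdiff_add_ncard_of_subset fun v hv => ⟨hv.1.2, hv.2⟩
    have h2 : R'.ncard ≤ R.ncard + M.ncard + N.ncard := by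
      rw [hsplit]
      exact (Set.ncard_union_le _ _).trans (Nat.add_le_add_right (Set.ncard_union_le _ _) _)
    have h3 : ((Rep ∪ M) \ {db}).ncard + 1 ≤ Rep.ncard + M.ncard := by
      rw [Set.ncard_sdiff_singleton_add_one hdb]
      exact Set.ncard_union_le _ _
    have h4 : N.ncard ≤ j := by
      have hne : x ≠ y := fun h => hxy (h ▸ .refl hx)
      have hSc : S.ncard ≤ j + 2 := by
        have : S = (P.support.toFinset : Set V) := by ext; simp [hS]
        rw [this, Set.ncard_coe_finset]
        exact (List.toFinset_card_le _).trans (by rw [P.length_support]; omega)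
      have hsub : ({x, y} : Set V) ⊆ S := by
        rintro v (rfl | rfl)
        · exact P.start_mem_support
        · exact P.end_mem_support
      have hNs : N ⊆ S \ {x, y} := fun v hv => ⟨hv.1.1, by
        rintro (rfl | rfl)
        · exact hZQ _ hx (hNQ hv)
        · exact hZQ _ hy (hNQ hv)⟩
      have := Set.ncard_le_ncard hNs
      have h5 := Set.ncard_sdiff_add_ncard_of_subset hsub
      rw [Set.ncard_pair hne] at h5
      omega
    rw [← h1] at hle
    nlinarith [Nat.mul_le_mul_left j h3]

end Budget

/-! ### Making a part connected -/

section Fill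

variable {V ι : Type u} {G : SimpleGraph V} {T : SimpleGraph ι} {td : TreeDecomp G T}
  {U C X Z : Set V} {v₀ : V}

/-- Two components of `Z` in `C ∪ N(C)` can be joined by a short path through `C \ Z`. -/
theorem IsPosition.exists_short_path [Finite V] (hU' : ∀ x ∈ U, ∀ y, G.Adj x y → y ∈ U) {ℓ : ℕ}
    (hℓ : GeneratesLE G ℓ) (hC : IsPosition td U v₀ C) (hCX : nbr G C ⊆ X)
    (hX : ∀ D, IsComp G (C \ X) D → IsPosition td U v₀ D) (hXZ : X ⊆ Z) (hZ : Z ⊆ C ∪ nbr G C)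
    (hZX : ∀ z ∈ Z, ∃ x ∈ X, ConnIn G Z z x) (hne : Z.Nonempty) (hnc : ¬ IsConnSet G Z) :
    ∃ x ∈ Z, ∃ y ∈ Z, ¬ ConnIn G Z x y ∧ ∃ q : G.Walk x y, q.IsPath ∧ q.length + 2 ≤ ℓ ∧
      ∀ w ∈ q.support, (w ∈ C ∧ w ∉ Z) ∨ w = x ∨ w = y := by
  have hAU : C ∪ nbr G C ⊆ U := by
    rintro v (hv | ⟨-, z, hz, hzv⟩)
    · exact hC.sub hv
    · exact hU' z (hC.sub hz) v hzv
  obtain ⟨x₀, hx₀, y₀, hy₀, hxy₀⟩ : ∃ x₀ ∈ Z, ∃ y₀ ∈ Z, ¬ ConnIn G Z x₀ y₀ := by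
    by_contra! h
    exact hnc ⟨hne, h⟩
  set Z₁ := {z | ConnIn G Z x₀ z} with hZ₁
  have hZ₁Z : Z₁ ⊆ Z := fun z hz => hz.mem_right
  obtain ⟨K, hK, z₁, hz₁, hz₁K, b, hb, hbK⟩ : ∃ K, IsComp G (C \ Z) K ∧
      ∃ z₁ ∈ Z₁, z₁ ∈ nbr G K ∧ ∃ b ∈ Z \ Z₁, b ∈ nbr G K := by
    obtain ⟨a, b, ha, hbA, hbS, hab⟩ := ((isConnSet_union_nbr hC.conn).2 x₀ (hZ hx₀) y₀
      (hZ hy₀)).exit (Q := Z₁ ∪ {v | ∃ K, IsComp G (C \ Z) K ∧ v ∈ K ∧ ∃ z ∈ Z₁, z ∈ nbr G K})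
        (.inl (.refl hx₀)) (by
          rintro (h | ⟨K, hK, hy, -⟩)
          · exact hxy₀ h
          · exact (hK.sub hy).2 hy₀)
    have hbC : b ∉ Z → b ∈ C \ Z := fun h => ⟨hbA.resolve_right fun h' => h (hXZ (hCX h')), h⟩
    rcases ha.mem_right.2 with haZ | ⟨K, hK, haK, z, hz, hzK⟩
    · exfalso
      by_cases hbZ : b ∈ Z
      · exact hbS (.inl (haZ.trans (.of_adj hab (hZ₁Z haZ) hbZ)))
      · obtain ⟨K, hK, hbK⟩ := exists_isComp (G := G) (hbC hbZ)
        exact hbS (.inr ⟨K, hK, hbK, a, haZ,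
          fun h => (hK.sub h).2 (hZ₁Z haZ), b, hbK, hab.symm⟩)
    · have hbZ : b ∈ Z := by
        by_contra hbZ
        exact hbS (.inr ⟨K, hK, hK.closed a haK b (hbC hbZ) hab, z, hz, hzK⟩)
      exact ⟨K, hK, z, hz, hzK, b, ⟨hbZ, fun h => hbS (.inl h)⟩,
        fun h => (hK.sub h).2 hbZ, a, haK, hab⟩
  have hZK : Z ⊆ Kᶜ := fun z hz hzK => (hK.sub hzK).2 hz
  have hconn : ∀ z ∈ Z, ConnIn G Kᶜ z v₀ := by
    intro z hz
    obtain ⟨x, hx, hzx⟩ := hZX z hz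
    obtain ⟨c, hc⟩ := hK.conn.1
    have hKX : K ⊆ C \ X := fun v hv => ⟨(hK.sub hv).1, fun h => (hK.sub hv).2 (hXZ h)⟩
    obtain ⟨C', hC', hcC'⟩ := exists_isComp (G := G) (hKX hc)
    refine (hzx.mono hZK).trans (((hX C' hC').connIn_compl (hAU (hZ (hXZ hx)))
      fun h => (hC'.sub h).2 hx).mono (Set.compl_subset_compl.2 ?_))
    exact hC'.subset_of_mem hK.conn hKX hcC' hc
  obtain ⟨x, hx, y, hy, q, hq, hlen, hsupp⟩ := exists_short_detour hℓ (Z := Z₁) (Z' := Z \ Z₁)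
    (Set.disjoint_left.2 fun z hz => hZK (hZ₁Z hz)) Set.disjoint_sdiff_right
    (fun z hz w hw h => hw.2 (hz.trans (.of_adj h (hZ₁Z hz) hw.1))) hK.conn
    (by
      rw [Set.union_sdiff_cancel hZ₁Z]
      exact hK.nbr_subset (hCX.trans hXZ)) hz₁K hbK hz₁ hb
    ((hconn z₁ (hZ₁Z hz₁)).trans (hconn b hb.1).symm)
  exact ⟨x, hZ₁Z hx, y, hy.1, fun h => hy.2 (hx.trans h), q, hq, hlen,
    fun w hw => (hsupp w hw).imp_left fun h => hK.sub h⟩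

/-- Filling up a part to a connected one without increasing the potentials. -/
theorem IsPosition.exists_fill [Finite V] (hU' : ∀ x ∈ U, ∀ y, G.Adj x y → y ∈ U) {j k : ℕ}
    (hℓ : GeneratesLE G (j + 3)) (hC : IsPosition td U v₀ C) (hCX : nbr G C ⊆ X)
    (hX : ∀ D, IsComp G (C \ X) D → IsPosition td U v₀ D) (hXZ : X ⊆ Z) (hZ : Z ⊆ C ∪ nbr G C)
    (hZX : ∀ z ∈ Z, ∃ x ∈ X, ConnIn G Z z x) (hne : Z.Nonempty)
    {𝒟 : Set (Set V)} {χ : Set V → Set V}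
    (hχ : ∀ D ∈ 𝒟, nbr G D ⊆ χ D ∧ χ D ⊆ D ∪ nbr G D)
    (hB : ∀ D ∈ 𝒟, Budget G j k (χ D) (Z ∩ (D ∪ nbr G D))) :
    ∃ W, Z ⊆ W ∧ W ⊆ C ∪ nbr G C ∧ IsConnSet G W ∧
      ∀ D ∈ 𝒟, Budget G j k (χ D) (W ∩ (D ∪ nbr G D)) := by
  induction h : ((C ∪ nbr G C) \ Z).ncard using Nat.strong_induction_on generalizing Z with
  | _ n ih =>
  by_cases hc : IsConnSet G Z
  · exact ⟨Z, subset_rfl, hZ, hc, hB⟩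
  obtain ⟨x, hx, y, hy, hxy, q, hq, hlen, hsupp⟩ :=
    hC.exists_short_path hU' hℓ hCX hX hXZ hZ hZX hne hc
  have hsub : Z ∪ {v | v ∈ q.support} ⊆ C ∪ nbr G C := by
    refine Set.union_subset hZ fun w hw => ?_
    rcases hsupp w hw with hw | rfl | rfl
    exacts [.inl hw.1, hZ hx, hZ hy]
  obtain ⟨p, hp, hpZ⟩ : ∃ p ∈ q.support, p ∉ Z := by
    by_contra! hall
    exact hxy ⟨q, hall⟩
  have hlt : ((C ∪ nbr G C) \ (Z ∪ {v | v ∈ q.support})).ncard < n := by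
    rw [← h]
    exact Set.ncard_lt_ncard ⟨Set.sdiff_subset_sdiff_right Set.subset_union_left,
      fun hs => (hs ⟨hsub (.inr hp), hpZ⟩).2 (.inr hp)⟩
  have hconn : ∀ z ∈ Z ∪ {v | v ∈ q.support},
      ∃ w ∈ X, ConnIn G (Z ∪ {v | v ∈ q.support}) z w := by
    have key : ∀ z ∈ Z, ∃ w ∈ X, ConnIn G (Z ∪ {v | v ∈ q.support}) z w := fun z hz => by
      obtain ⟨w, hw, hzw⟩ := hZX z hz
      exact ⟨w, hw, hzw.mono Set.subset_union_left⟩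
    rintro z (hz | hz)
    · exact key z hz
    · classical
      obtain ⟨w, hw, hxw⟩ := key x hx
      refine ⟨w, hw, ConnIn.trans (ConnIn.symm ?_) hxw⟩
      exact ⟨q.takeUntil z hz, fun v hv => .inr (q.support_takeUntil_subset_support hz hv)⟩
  obtain ⟨W, hW, hW'⟩ := ih _ hlt (hXZ.trans Set.subset_union_left) hsub hconn
    (hne.mono Set.subset_union_left) (fun D hD => (hB D hD).union_path (hχ D hD).2 (hχ D hD).1
      q hq hx hy (fun v hv hvZ => (hsupp v hv).resolve_left fun h => h.2 hvZ) hxy (by omega)) rfl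
  exact ⟨W, Set.subset_union_left.trans hW, hW'⟩

end Fill

/-! ### Gluing tree-decompositions -/

section Glue

/-- Bridges stay bridges when a graph is embedded as a union of components. -/
theorem SimpleGraph.IsBridge.of_closed_range {α β : Type*} {T : SimpleGraph α} {H : SimpleGraph β}
    (f : T ↪g H) (hf : ∀ a y, H.Adj (f a) y → ∃ b, f b = y) {a b : α} (h : T.IsBridge s(a, b)) :
    H.IsBridge s(f a, f b) := by
  have key : ∀ {x y : β} (p : H.Walk x y) (c : α), f c = x →
      ∃ (d : α) (q : T.Walk c d), f d = y ∧ ∀ e ∈ q.edges, e.map f ∈ p.edges := by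
    intro x y p
    induction p with
    | nil => exact fun c hc => ⟨c, .nil, hc, by simp⟩
    | @cons u v w huv p ih =>
      rintro c rfl
      obtain ⟨c', rfl⟩ := hf c v huv
      obtain ⟨d, q, hd, hq⟩ := ih c' rfl
      refine ⟨d, .cons (f.map_adj_iff.1 huv) q, hd, fun e he => ?_⟩
      rw [Walk.edges_cons, List.mem_cons] at he ⊢
      rcases he with rfl | he
      · exact .inl rfl
      · exact .inr (hq e he)
  rw [isBridge_iff_forall_walk_mem_edges] at h ⊢
  intro p
  obtain ⟨d, q, hd, hq⟩ := key p a rfl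
  obtain rfl := f.injective hd
  exact hq _ (h q)

theorem SimpleGraph.IsAcyclic.sum {α β : Type*} {T₁ : SimpleGraph α} {T₂ : SimpleGraph β}
    (h₁ : T₁.IsAcyclic) (h₂ : T₂.IsAcyclic) : (T₁ ⊕g T₂).IsAcyclic := by
  rw [isAcyclic_iff_forall_adj_isBridge] at h₁ h₂ ⊢
  rintro (a | a) (b | b) hab
  · exact IsBridge.of_closed_range Embedding.sumInl
      (by rintro c (y | y) hy; exacts [⟨y, rfl⟩, (Bool.false_ne_true hy).elim]) (h₁ hab)
  · exact (Bool.false_ne_true hab).elim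
  · exact (Bool.false_ne_true hab).elim
  · exact IsBridge.of_closed_range Embedding.sumInr
      (by rintro c (y | y) hy; exacts [(Bool.false_ne_true hy).elim, ⟨y, rfl⟩]) (h₂ hab)

theorem SimpleGraph.IsTree.sum_sup_edge {α β : Type*} {T₁ : SimpleGraph α} {T₂ : SimpleGraph β}
    (h₁ : T₁.IsTree) (h₂ : T₂.IsTree) (a : α) (b : β) :
    ((T₁ ⊕g T₂) ⊔ edge (.inl a) (.inr b)).IsTree :=
  ⟨h₁.connected.sum_sup_edge h₂.connected,
    (h₁.isAcyclic.sum h₂.isAcyclic).sup_edge_of_not_reachable (not_reachable_sum_inl_inr a b)⟩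

theorem ConnIn.map {α β : Type u} {T : SimpleGraph α} {H : SimpleGraph β} (f : T →g H)
    {S : Set α} {S' : Set β} {x y : α} (h : ConnIn T S x y) (hS : ∀ a ∈ S, f a ∈ S') :
    ConnIn H S' (f x) (f y) := by
  obtain ⟨p, hp⟩ := h
  refine ⟨p.map f, fun v hv => ?_⟩
  rw [Walk.support_map, List.mem_map] at hv
  obtain ⟨a, ha, rfl⟩ := hv
  exact hS a (hp a ha)

variable {V : Type u} {G : SimpleGraph V} {K : ℕ} {A A₁ A₂ S S₁ S₂ W : Set V}

/-- `G[A]` has a tree-decomposition into parts that are connected in `G` and have at most `K`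
vertices, one of the parts containing `S`. -/
def HasConnTD (G : SimpleGraph V) (K : ℕ) (A S : Set V) : Prop :=
  ∃ (ι : Type u) (T : SimpleGraph ι) (bag : ι → Set V) (t₀ : ι), T.IsTree ∧ S ⊆ bag t₀ ∧
    (∀ t, bag t ⊆ A ∧ IsConnSet G (bag t) ∧ (bag t).ncard ≤ K) ∧ (∀ v ∈ A, ∃ t, v ∈ bag t) ∧
    (∀ x ∈ A, ∀ y ∈ A, G.Adj x y → ∃ t, x ∈ bag t ∧ y ∈ bag t) ∧
    ∀ v t₁ t₂, v ∈ bag t₁ → v ∈ bag t₂ → ConnIn T {t | v ∈ bag t} t₁ t₂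

theorem HasConnTD.subset (h : HasConnTD G K A S) : S ⊆ A := by
  obtain ⟨ι, T, bag, t₀, -, hS, hb, -⟩ := h
  exact hS.trans (hb t₀).1

theorem HasConnTD.mono (h : HasConnTD G K A S) (hS : S₁ ⊆ S) : HasConnTD G K A S₁ := by
  obtain ⟨ι, T, bag, t₀, hT, hS', h⟩ := h
  exact ⟨ι, T, bag, t₀, hT, hS.trans hS', h⟩

theorem IsConnSet.hasConnTD (h : IsConnSet G W) (hW : W.ncard ≤ K) : HasConnTD G K W W :=
  ⟨PUnit, ⊥, fun _ => W, ⟨⟩, .of_subsingleton, subset_rfl, fun _ => ⟨subset_rfl, h, hW⟩,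
    fun _ hv => ⟨⟨⟩, hv⟩, fun _ hx _ hy _ => ⟨⟨⟩, hx, hy⟩, fun _ _ _ hv _ => .refl hv⟩

theorem HasConnTD.union (h₁ : HasConnTD G K A₁ S₁) (h₂ : HasConnTD G K A₂ S₂)
    (hA : A₁ ∩ A₂ ⊆ S₁ ∩ S₂) (hadj : ∀ x ∈ A₁ \ A₂, ∀ y ∈ A₂ \ A₁, ¬ G.Adj x y) :
    HasConnTD G K (A₁ ∪ A₂) S₁ := by
  obtain ⟨ι₁, T₁, b₁, r₁, hT₁, hS₁, hb₁, hv₁, he₁, hc₁⟩ := h₁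
  obtain ⟨ι₂, T₂, b₂, r₂, hT₂, hS₂, hb₂, hv₂, he₂, hc₂⟩ := h₂
  set T := (T₁ ⊕g T₂) ⊔ edge (.inl r₁) (.inr r₂) with hT
  have hadj' : T.Adj (.inl r₁) (.inr r₂) := by simp [hT, edge]
  have hl : ∀ v t s, v ∈ b₁ t → v ∈ b₁ s →
      ConnIn T {t | v ∈ Sum.elim b₁ b₂ t} (.inl t) (.inl s) := fun v t s ht hs =>
    (hc₁ v t s ht hs).map ((Hom.ofLE le_sup_left).comp Embedding.sumInl.toHom) fun _ ha => ha
  have hr : ∀ v t s, v ∈ b₂ t → v ∈ b₂ s →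
      ConnIn T {t | v ∈ Sum.elim b₁ b₂ t} (.inr t) (.inr s) := fun v t s ht hs =>
    (hc₂ v t s ht hs).map ((Hom.ofLE le_sup_left).comp Embedding.sumInr.toHom) fun _ ha => ha
  have hlr : ∀ v t s, v ∈ b₁ t → v ∈ b₂ s →
      ConnIn T {t | v ∈ Sum.elim b₁ b₂ t} (.inl t) (.inr s) := fun v t s ht hs => by
    obtain ⟨h1, h2⟩ := hA ⟨(hb₁ t).1 ht, (hb₂ s).1 hs⟩
    exact (hl v t r₁ ht (hS₁ h1)).trans ((ConnIn.of_adj hadj' (hS₁ h1) (hS₂ h2)).trans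
      (hr v r₂ s (hS₂ h2) hs))
  have hcross : ∀ x ∈ A₁, ∀ y ∈ A₂, G.Adj x y →
      ∃ t, x ∈ Sum.elim b₁ b₂ t ∧ y ∈ Sum.elim b₁ b₂ t := by
    intro x hx y hy hxy
    by_cases hx₂ : x ∈ A₂
    · obtain ⟨t, ht⟩ := he₂ x hx₂ y hy hxy
      exact ⟨.inr t, ht⟩
    by_cases hy₁ : y ∈ A₁
    · obtain ⟨t, ht⟩ := he₁ x hx y hy₁ hxy
      exact ⟨.inl t, ht⟩
    · exact (hadj x ⟨hx, hx₂⟩ y ⟨hy, hy₁⟩ hxy).elim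
  refine ⟨ι₁ ⊕ ι₂, T, Sum.elim b₁ b₂, .inl r₁, hT₁.sum_sup_edge hT₂ r₁ r₂, hS₁, ?_, ?_, ?_, ?_⟩
  · rintro (t | t)
    · exact ⟨(hb₁ t).1.trans Set.subset_union_left, (hb₁ t).2⟩
    · exact ⟨(hb₂ t).1.trans Set.subset_union_right, (hb₂ t).2⟩
  · rintro v (hv | hv)
    · obtain ⟨t, ht⟩ := hv₁ v hv
      exact ⟨.inl t, ht⟩
    · obtain ⟨t, ht⟩ := hv₂ v hv
      exact ⟨.inr t, ht⟩
  · rintro x (hx | hx) y (hy | hy) hxy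
    · obtain ⟨t, ht⟩ := he₁ x hx y hy hxy
      exact ⟨.inl t, ht⟩
    · exact hcross x hx y hy hxy
    · obtain ⟨t, ht⟩ := hcross y hy x hx hxy.symm
      exact ⟨t, ht.symm⟩
    · obtain ⟨t, ht⟩ := he₂ x hx y hy hxy
      exact ⟨.inr t, ht⟩
  · rintro v (t | t) (s | s) ht hs
    · exact hl v t s ht hs
    · exact hlr v t s ht hs
    · exact (hlr v s t hs ht).symm
    · exact hr v t s ht hs

theorem HasConnTD.biUnion (h : HasConnTD G K A S) {I : Type*} {s : Set I} (hs : s.Finite)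
    {B : I → Set V} (hB : ∀ i ∈ s, HasConnTD G K (B i) (S ∩ B i)) (hA : ∀ i ∈ s, A ∩ B i ⊆ S)
    (hBB : ∀ i ∈ s, ∀ i' ∈ s, i ≠ i' → B i ∩ B i' ⊆ S)
    (hadj : ∀ i ∈ s, ∀ x ∈ B i, ∀ y, y ∉ B i → G.Adj x y → x ∈ S) :
    HasConnTD G K (A ∪ ⋃ i ∈ s, B i) S := by
  induction s, hs using Set.Finite.induction_on with
  | empty => simpa using h
  | @insert i s hi _ ih =>
    have h' := ih (fun a ha => hB a (.inr ha)) (fun a ha => hA a (.inr ha))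
      (fun a ha b hb => hBB a (.inr ha) b (.inr hb)) (fun a ha => hadj a (.inr ha))
    rw [Set.biUnion_insert, Set.union_comm (B i), ← Set.union_assoc]
    refine h'.union (hB i (.inl rfl)) ?_ ?_
    · have : (A ∪ ⋃ i ∈ s, B i) ∩ B i ⊆ S := by
        rintro v ⟨hv | hv, hvi⟩
        · exact hA i (.inl rfl) ⟨hv, hvi⟩
        · obtain ⟨i', hi', hvi'⟩ := Set.mem_iUnion₂.1 hv
          exact hBB i (.inl rfl) i' (.inr hi') (fun h => hi (h ▸ hi')) ⟨hvi, hvi'⟩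
      exact fun v hv => ⟨this hv, this hv, hv.2⟩
    · intro x hx y hy hxy
      exact hy.2 (.inl (h.subset (hadj i (.inl rfl) y hy.1 x hx.2 hxy.symm)))

theorem HasConnTD.exists_treeDecomp (h : HasConnTD G K Set.univ S) :
    ∃ (ι : Type u) (T : SimpleGraph ι) (td : TreeDecomp G T),
      td.IsConn ∧ ∀ t, (td.bag t).ncard ≤ K := by
  classical
  obtain ⟨ι, T, bag, -, hT, -, hb, hv, he, hc⟩ := h
  refine ⟨ι, T, ⟨hT, bag, fun v => hv v trivial, fun u v => he u trivial v trivial, ?_⟩,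
    fun t => (hb t).2.1, fun t => (hb t).2.2⟩
  rintro t₁ t₃ p hp t₂ ht₂ v ⟨h₁, h₃⟩
  obtain ⟨q, hq⟩ := hc v t₁ t₃ h₁ h₃
  rw [(hT.existsUnique_path t₁ t₃).unique hp q.bypass_isPath] at ht₂
  exact hq t₂ (q.support_bypass_subset_support ht₂)

end Glue

/-! ### The recursive construction -/

section Recursion

variable {V ι : Type u} {G : SimpleGraph V} {T : SimpleGraph ι} {td : TreeDecomp G T}
  {U C : Set V} {v₀ : V}

theorem IsComp.union_nbr_inter_subset {X C₁ C₂ : Set V} (h₁ : IsComp G (C \ X) C₁)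
    (h₂ : IsComp G (C \ X) C₂) (hX : nbr G C ⊆ X) (hne : C₁ ≠ C₂) :
    (C₁ ∪ nbr G C₁) ∩ (C₂ ∪ nbr G C₂) ⊆ X := by
  rintro v ⟨hv₁ | hv₁, hv₂ | hv₂⟩
  · exact (hne (h₁.eq_of_mem h₂ hv₁ hv₂)).elim
  · exact h₂.nbr_subset hX hv₂
  · exact h₁.nbr_subset hX hv₁
  · exact h₁.nbr_subset hX hv₁

theorem mem_nbr_of_adj {x y : V} (hx : x ∈ C ∪ nbr G C) (hy : y ∉ C ∪ nbr G C)
    (hxy : G.Adj x y) : x ∈ nbr G C :=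
  hx.resolve_left fun h => hy (.inr ⟨fun h' => hy (.inl h'), x, h, hxy⟩)

theorem union_nbr_mono {D : Set V} (h : D ⊆ C) : D ∪ nbr G D ⊆ C ∪ nbr G C := by
  rintro v (hv | ⟨-, z, hz, hzv⟩)
  · exact .inl (h hv)
  · by_cases hvC : v ∈ C
    · exact .inl hvC
    · exact .inr ⟨hvC, z, h hz, hzv⟩

theorem IsPosition.hasConnTD [Finite V] (hU : IsConnSet G U)
    (hU' : ∀ x ∈ U, ∀ y, G.Adj x y → y ∈ U) (hv₀ : v₀ ∈ U) {j k : ℕ}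
    (hℓ : GeneratesLE G (j + 3)) {χ : Set V → Set V}
    (hχ : ∀ C, IsPosition td U v₀ C → nbr G C ⊆ χ C ∧ χ C ⊆ C ∪ nbr G C ∧ (χ C ∩ C).Nonempty ∧
      (χ C).ncard ≤ k + 1 ∧ ∀ D, IsComp G (C \ χ C) D → IsPosition td U v₀ D)
    (hC : IsPosition td U v₀ C) {Z : Set V} (hZ : Z ⊆ C ∪ nbr G C)
    (hZN : ∀ z ∈ Z, ∃ x ∈ nbr G C, ConnIn G Z z x)
    (hB : ∀ D, IsPosition td U v₀ D → D ⊆ C → Budget G j k (χ D) (Z ∩ (D ∪ nbr G D))) :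
    HasConnTD G (k * (j + 1) + 1) (C ∪ nbr G C) Z := by
  induction h : C.ncard using Nat.strong_induction_on generalizing C Z with
  | _ n ih =>
  obtain ⟨hCX, hXC, hXne, -, hX⟩ := hχ C hC
  set X := χ C with hXdef
  have hZX : ∀ z ∈ Z ∪ X, ∃ x ∈ X, ConnIn G (Z ∪ X) z x := by
    rintro z (hz | hz)
    · obtain ⟨x, hx, hzx⟩ := hZN z hz
      exact ⟨x, hCX hx, hzx.mono Set.subset_union_left⟩
    · exact ⟨z, hz, .refl (.inr hz)⟩
  obtain ⟨W, hZW, hWC, hW, hWB⟩ := hC.exists_fill (j := j) (k := k)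
    (𝒟 := {D | IsPosition td U v₀ D ∧ (D = C ∨ D ⊆ C \ X)}) (χ := χ) hU' hℓ hCX hX
    Set.subset_union_right (Set.union_subset hZ hXC) hZX (hXne.mono fun v hv => .inr hv.1)
    (fun D hD => ⟨(hχ D hD.1).1, (hχ D hD.1).2.1⟩) (by
      rintro D ⟨hD, hDC⟩
      rw [Set.union_inter_distrib_right]
      rcases hDC with rfl | hDC
      · exact (hB D hD subset_rfl).union Set.inter_subset_left
      · exact (hB D hD fun v hv => (hDC hv).1).union fun v hv =>
          (hχ D hD).1 (hv.2.resolve_left fun h => (hDC h).2 hv.1))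
  have hXW : X ⊆ W := Set.subset_union_right.trans hZW
  have hWcard : W.ncard ≤ k * (j + 1) + 1 := by
    have := hWB C ⟨hC, .inl rfl⟩
    rw [Set.inter_eq_left.2 hWC] at this
    exact this.ncard_le hW.1
  have hcover : C ∪ nbr G C = W ∪ ⋃ D ∈ {D | IsComp G (C \ X) D}, (D ∪ nbr G D) := by
    refine subset_antisymm ?_ (Set.union_subset hWC (Set.iUnion₂_subset fun D hD =>
      union_nbr_mono fun v hv => (hD.sub hv).1))
    intro v hv
    by_cases hvX : v ∈ X
    · exact .inl (hXW hvX)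
    · obtain ⟨D, hD, hvD⟩ := exists_isComp (G := G) (S := C \ X)
        ⟨hv.resolve_right fun h => hvX (hCX h), hvX⟩
      exact .inr (Set.mem_iUnion₂.2 ⟨D, hD, .inl hvD⟩)
  rw [hcover]
  refine ((hW.hasConnTD hWcard).biUnion (Set.toFinite _) ?_ (fun _ _ => Set.inter_subset_left)
    (fun D hD D' hD' hne => (IsComp.union_nbr_inter_subset hD hD' hCX hne).trans hXW)
    (fun D hD x hx y hy hxy => hXW (IsComp.nbr_subset hD hCX (mem_nbr_of_adj hx hy hxy)))).mono
    (Set.subset_union_left.trans hZW)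
  intro D (hD : IsComp G (C \ X) D)
  have hDC : D ⊆ C := fun v hv => (hD.sub hv).1
  have hlt : D.ncard < n := by
    obtain ⟨v, hvX, hvC⟩ := hXne
    rw [← h]
    exact Set.ncard_lt_ncard ⟨hDC, fun hs => (hD.sub (hs hvC)).2 hvX⟩
  refine ih _ hlt (hX D hD) Set.inter_subset_right ?_ ?_ rfl
  · rintro z ⟨hzW, hzD | hzD⟩
    · obtain ⟨x, hx⟩ := (hX D hD).nbr_nonempty hU hv₀
      obtain ⟨a, b, hza, hbW, hbD, hab⟩ :=
        (hW.2 z hzW x (hXW (hD.nbr_subset hCX hx))).exit hzD hx.1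
      have hb : b ∈ nbr G D := ⟨hbD, a, hza.mem_right.2, hab⟩
      have hza' := hza.mono (Set.inter_subset_inter_right W (Set.subset_union_left (t := nbr G D)))
      exact ⟨b, hb, hza'.trans (.of_adj hab hza'.mem_right ⟨hbW, .inr hb⟩)⟩
    · exact ⟨z, hzD, .refl ⟨hzW, .inr hzD⟩⟩
  · intro D' hD' hDD'
    rw [Set.inter_assoc, Set.inter_eq_right.2 (union_nbr_mono hDD')]
    exact hWB D' ⟨hD', .inr (hDD'.trans hD.sub)⟩

theorem IsPosition.of_isComp_sdiff_singleton (td : TreeDecomp G T) (hU : IsConnSet G U)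
    (hU' : ∀ x ∈ U, ∀ y, G.Adj x y → y ∈ U) (hv₀ : v₀ ∈ U) (hC : IsComp G (U \ {v₀}) C) :
    IsPosition td U v₀ C ∧ nbr G C ⊆ {v₀} := by
  have hnbr : nbr G C ⊆ {v₀} := hC.nbr_subset (by
    rintro y ⟨hy, z, hz, hzy⟩
    exact (hy (hU' z hz y hzy)).elim)
  obtain ⟨t, ht⟩ := td.exists_bag v₀
  refine ⟨⟨hC.conn, fun v hv => (hC.sub hv).1, ?_, fun h => (hC.sub h).2 rfl, t,
    hnbr.trans (Set.singleton_subset_iff.2 ht)⟩, hnbr⟩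
  rintro v ⟨hv, hvc⟩
  by_contra hvC
  rcases (hU.2 v hv v₀ hv₀).inter_or_exit (Q := Cᶜ) hvC with h | ⟨a, b, ha, -, hb, hab⟩
  · exact hvc (h.mono Set.inter_subset_right)
  · have : a ∈ nbr G C := ⟨ha.mem_right.2, b, not_not.1 hb, hab.symm⟩
    obtain rfl : a = v₀ := hnbr this
    exact hvc (ha.mono Set.inter_subset_right)

theorem IsConnSet.hasConnTD_of_closed [Finite V] (td : TreeDecomp G T) (hU : IsConnSet G U)
    (hU' : ∀ x ∈ U, ∀ y, G.Adj x y → y ∈ U) {j k : ℕ} (hℓ : GeneratesLE G (j + 3))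
    (hk : ∀ t, (td.bag t).ncard ≤ k + 1) : HasConnTD G (k * (j + 1) + 1) U ∅ := by
  obtain ⟨v₀, hv₀⟩ := hU.1
  have hmove := fun C (hC : IsPosition td U v₀ C) => hC.exists_move hU hU' hv₀ hk
  choose! χ hχ using hmove
  have hnbr : nbr G U ⊆ {v₀} := by
    rintro y ⟨hy, z, hz, hzy⟩
    exact (hy (hU' z hz y hzy)).elim
  have hcover : U = {v₀} ∪ ⋃ D ∈ {D | IsComp G (U \ {v₀}) D}, (D ∪ nbr G D) := by
    refine subset_antisymm (fun v hv => ?_) (Set.union_subset (Set.singleton_subset_iff.2 hv₀)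
      (Set.iUnion₂_subset fun D hD => Set.union_subset (fun v hv => (hD.sub hv).1) ?_))
    · by_cases hvX : v ∈ ({v₀} : Set V)
      · exact .inl hvX
      · obtain ⟨D, hD, hvD⟩ := exists_isComp (G := G) (S := U \ {v₀}) ⟨hv, hvX⟩
        exact .inr (Set.mem_iUnion₂.2 ⟨D, hD, .inl hvD⟩)
    · exact (hD.nbr_subset hnbr).trans (Set.singleton_subset_iff.2 hv₀)
  rw [hcover]
  refine (((IsConnSet.singleton G v₀).hasConnTD (K := k * (j + 1) + 1) (by simp)).biUnion
    (Set.toFinite _) ?_ (fun _ _ => Set.inter_subset_left)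
    (fun D hD D' hD' hne => IsComp.union_nbr_inter_subset hD hD' hnbr hne)
    (fun D hD x hx y hy hxy => IsComp.nbr_subset hD hnbr (mem_nbr_of_adj hx hy hxy))).mono
    (Set.empty_subset _)
  intro D hD
  obtain ⟨hDpos, hDn⟩ := IsPosition.of_isComp_sdiff_singleton td hU hU' hv₀ hD
  refine hDpos.hasConnTD hU hU' hv₀ hℓ hχ Set.inter_subset_right ?_ fun D' hD' _ => ?_
  · rintro z ⟨rfl, hz⟩
    exact ⟨z, hz.resolve_left hDpos.base, .refl ⟨rfl, hz⟩⟩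
  · have hsub : {v₀} ∩ (D ∪ nbr G D) ∩ (D' ∪ nbr G D') ⊆ χ D' := by
      rintro v ⟨⟨rfl, -⟩, hv⟩
      exact (hχ D' hD').1 (hv.resolve_left hD'.base)
    simpa using (Budget.empty (G := G) (j := j) (hχ D' hD').2.2.2.1).union hsub

theorem exists_connected_treeDecomp [Finite V] [Nonempty V] (td : TreeDecomp G T) {j k : ℕ}
    (hℓ : GeneratesLE G (j + 3)) (hk : ∀ t, (td.bag t).ncard ≤ k + 1) :
    ∃ (κ : Type u) (T' : SimpleGraph κ) (td' : TreeDecomp G T'),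
      td'.IsConn ∧ ∀ t, (td'.bag t).ncard ≤ k * (j + 1) + 1 := by
  have hTD : ∀ U, IsComp G Set.univ U → HasConnTD G (k * (j + 1) + 1) U ∅ := fun U hU =>
    hU.conn.hasConnTD_of_closed td (fun x hx y hxy => hU.closed x hx y trivial hxy) hℓ hk
  obtain ⟨v⟩ := ‹Nonempty V›
  obtain ⟨U, hU, -⟩ := exists_isComp (G := G) (Set.mem_univ v)
  have h := (hTD U hU).biUnion (s := {D | IsComp G Set.univ D ∧ D ≠ U}) (B := id) (Set.toFinite _)
    (fun D hD => by simpa using hTD D hD.1)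
    (fun D hD x hx => hD.2 (IsComp.eq_of_mem hD.1 hU hx.2 hx.1))
    (fun D hD D' hD' hne x hx => hne (IsComp.eq_of_mem hD.1 hD'.1 hx.1 hx.2))
    (fun D hD x hx y hy hxy => hy (hD.1.closed x hx y trivial hxy))
  refine HasConnTD.exists_treeDecomp (S := ∅) ?_
  convert h
  refine (Set.eq_univ_of_forall fun w => ?_).symm
  obtain ⟨D, hD, hwD⟩ := exists_isComp (G := G) (Set.mem_univ w)
  by_cases hDU : D = U
  · exact .inl (hDU ▸ hwD)
  · exact .inr (Set.mem_iUnion₂.2 ⟨D, ⟨hD, hDU⟩, hwD⟩)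

end Recursion

/-! ### Attaining the tree-width and `ℓ(G)` -/

section Attained

variable {V : Type u}

theorem exists_treeDecomp_treewidth (G : SimpleGraph V) :
    ∃ (ι : Type u) (T : SimpleGraph ι) (td : TreeDecomp G T),
      ∀ t, (td.bag t).ncard ≤ treewidth G + 1 :=
  Nat.sInf_mem (s := {k | ∃ (ι : Type u) (T : SimpleGraph ι) (td : TreeDecomp G T),
    ∀ t, (td.bag t).ncard ≤ k + 1}) ⟨(Set.univ : Set V).ncard, PUnit, ⊥,
      ⟨.of_subsingleton, fun _ => Set.univ, fun _ => ⟨⟨⟩, trivial⟩,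
        fun _ _ _ => ⟨⟨⟩, trivial, trivial⟩, fun _ _ _ _ _ _ _ _ => trivial⟩,
      fun _ => Nat.le_succ _⟩

theorem generatesLE_ellGraph [Finite V] (G : SimpleGraph V) : GeneratesLE G (ellGraph G) := by
  classical
  have := Fintype.ofFinite V
  refine Nat.sInf_mem (s := {ℓ | GeneratesLE G ℓ}) ⟨Fintype.card V, fun v p hp =>
    Submodule.subset_span ⟨v, p, hp, ?_, rfl⟩⟩
  have := hp.support_nodup.length_le_card
  simpa using this

theorem three_le_ellGraph [Finite V] {G : SimpleGraph V} {v : V} {p : G.Walk v v}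
    (hp : p.IsCycle) : 3 ≤ ellGraph G := by
  by_contra! hlt
  have hempty : cycleChars G (ellGraph G) = ∅ := by
    refine Set.eq_empty_of_forall_notMem ?_
    rintro f ⟨w, q, hq, hlen, -⟩
    have := hq.three_le_length
    omega
  have h0 := generatesLE_ellGraph G p hp
  rw [hempty, Submodule.span_empty, Submodule.mem_bot] at h0
  obtain ⟨e, he⟩ := List.exists_mem_of_ne_nil p.edges (by
    intro h
    have h1 := hp.three_le_length
    have h2 := p.length_edges
    rw [h] at h2
    simp at h2
    omega)
  have := congrFun h0 e
  simp [walkChar, he] at this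

end Attained

/-- Main result: every graph containing a cycle has a connected
tree-decomposition of width at most `tw(G) · (ℓ(G) − 2)`. -/
theorem ctw_bound {V : Type u} [Finite V] (G : SimpleGraph V)
    (hc : ∃ (v : V) (p : G.Walk v v), p.IsCycle) :
    ∃ (ι : Type u) (T : SimpleGraph ι) (td : TreeDecomp G T),
      td.IsConn ∧ ∀ t, (td.bag t).ncard ≤ treewidth G * (ellGraph G - 2) + 1 := by
  obtain ⟨v, p, hp⟩ := hc
  have : Nonempty V := ⟨v⟩
  obtain ⟨ι, T, td, hk⟩ := exists_treeDecomp_treewidth G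
  obtain ⟨j, hj⟩ := Nat.exists_eq_add_of_le (three_le_ellGraph hp)
  have hℓ := generatesLE_ellGraph G
  rw [hj, Nat.add_comm] at hℓ
  have hj' : ellGraph G - 2 = j + 1 := by omega
  rw [hj']
  exact exists_connected_treeDecomp td hℓ hk
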